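/- Let k be an algebraically closed field of characteristic 0, let m be an odd positive integer, let q ∈ k be a primitive m-th root of unity, and let 1 ≤ r ≤ n. Then deg A_{n,r} = m^{nr − r(r+1)/2}; equivalently, the supremum of dim_k V over all finite-dimensional irreducible A_{n,r}-modules V equals m^{nr − r(r+1)/2}. -/

import Mathlib

open scoped BigOperators

/-- `p` is a polynomial identity of the ring `A`. -/
def IsPolyIdentity (A : Type) [Ring A] (p : FreeAlgebra ℤ ℕ) : Prop :=
  ∀ f : ℕ → A, FreeAlgebra.lift ℤ f p = 0

/-- `A` has degree at most `d`: it satisfies all polynomial identities of `d × d`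
matrices over commutative rings. -/
def DegLE (A : Type) [Ring A] (d : ℕ) : Prop :=
  ∀ p : FreeAlgebra ℤ ℕ,
    (∀ (R : Type) [CommRing R], IsPolyIdentity (Matrix (Fin d) (Fin d) R) p) →
    IsPolyIdentity A p

/-- `deg A = d`. -/
def HasDeg (A : Type) [Ring A] (d : ℕ) : Prop :=
  DegLE A d ∧ ∀ e : ℕ, DegLE A e → d ≤ e

/-- `A` satisfies a (nonzero) multilinear identity of degree `b`. -/
def SatisfiesMultilinearIdentity (A : Type) [Ring A] (b : ℕ) : Prop :=
  ∃ c : Equiv.Perm (Fin b) → ℤ, c ≠ 0 ∧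
    ∀ f : Fin b → A,
      ∑ σ : Equiv.Perm (Fin b), c σ • (List.ofFn fun i => f (σ i)).prod = 0

/-- The P.I. degree of `A`: half the smallest degree of a multilinear identity of `A`. -/
noncomputable def piDeg (A : Type) [Ring A] : ℕ :=
  sInf {b : ℕ | 0 < b ∧ SatisfiesMultilinearIdentity A b} / 2

/-- `A` is a P.I. algebra. -/
def IsPIAlgebra (A : Type) [Ring A] : Prop :=
  ∃ b : ℕ, 0 < b ∧ SatisfiesMultilinearIdentity A b

/-- `A` is a prime ring. -/
def IsPrimeRing' (A : Type) [Ring A] : Prop :=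
  ∀ a b : A, (∀ x : A, a * x * b = 0) → a = 0 ∨ b = 0

/-- A two-sided ideal is maximal. -/
def TwoSidedIdeal.IsMaximal' {A : Type} [Ring A] (I : TwoSidedIdeal A) : Prop :=
  I ≠ ⊤ ∧ ∀ J : TwoSidedIdeal A, I < J → J = ⊤



/-- Defining relations of the quantized matrix algebra `M_q(n,r)` (generators `Z (i,j)`). -/
inductive QMatRel (k : Type) [Field k] (q : k) (n r : ℕ) :
    FreeAlgebra k (Fin n × Fin r) → FreeAlgebra k (Fin n × Fin r) → Prop
  | row (i : Fin n) (j l : Fin r) (h : j < l) :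
      QMatRel k q n r (FreeAlgebra.ι k (i, j) * FreeAlgebra.ι k (i, l))
        (q • (FreeAlgebra.ι k (i, l) * FreeAlgebra.ι k (i, j)))
  | col (i s : Fin n) (j : Fin r) (h : i < s) :
      QMatRel k q n r (FreeAlgebra.ι k (i, j) * FreeAlgebra.ι k (s, j))
        (q • (FreeAlgebra.ι k (s, j) * FreeAlgebra.ι k (i, j)))
  | cross (i s : Fin n) (j l : Fin r) (h1 : i < s) (h2 : l < j) :
      QMatRel k q n r (FreeAlgebra.ι k (i, j) * FreeAlgebra.ι k (s, l))
        (FreeAlgebra.ι k (s, l) * FreeAlgebra.ι k (i, j))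
  | diag (i s : Fin n) (j l : Fin r) (h1 : i < s) (h2 : j < l) :
      QMatRel k q n r (FreeAlgebra.ι k (i, j) * FreeAlgebra.ι k (s, l))
        (FreeAlgebra.ι k (s, l) * FreeAlgebra.ι k (i, j) +
          (q - q⁻¹) • (FreeAlgebra.ι k (i, l) * FreeAlgebra.ι k (s, j)))

/-- The quantized matrix algebra `M_q(n,r)`. -/
abbrev QMat (k : Type) [Field k] (q : k) (n r : ℕ) : Type := RingQuot (QMatRel k q n r)

/-- The generator `Z_{i,j}` of `M_q(n,r)`. -/
noncomputable def Zgen (k : Type) [Field k] (q : k) (n r : ℕ) (i : Fin n) (j : Fin r) :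
    QMat k q n r :=
  RingQuot.mkAlgHom k (QMatRel k q n r) (FreeAlgebra.ι k (i, j))

/-- Number of inversions (the length) of a permutation. -/
def invCount {t : ℕ} (σ : Equiv.Perm (Fin t)) : ℕ :=
  (Finset.univ.filter (fun p : Fin t × Fin t => p.1 < p.2 ∧ σ p.2 < σ p.1)).card

/-- The `t × t` quantum minor on rows `row 0 < ... < row (t-1)` and columns
`col 0 < ... < col (t-1)`. -/
noncomputable def qMinor (k : Type) [Field k] (q : k) (n r : ℕ) (t : ℕ)
    (row : Fin t → Fin n) (col : Fin t → Fin r) : QMat k q n r :=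
  ∑ σ : Equiv.Perm (Fin t),
    ((-q) ^ invCount σ) • (List.ofFn fun a => Zgen k q n r (row a) (col (σ a))).prod


/-- The set of all `t × t` quantum minors of `M_q(n)` (rows `ro 0 < ... < ro (t-1)`,
columns `co 0 < ... < co (t-1)`). -/
def minorSet (k : Type) [Field k] (q : k) (n t : ℕ) : Set (QMat k q n n) :=
  {x | ∃ ro co : Fin t → Fin n, StrictMono ro ∧ StrictMono co ∧ x = qMinor k q n n t ro co}

/-- The relation identifying every `t × t` quantum minor of `M_q(n)` with `0`; the
corresponding `RingQuot` is the quotient of `M_q(n)` by the two-sided ideal `I^t_q`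
generated by all `t × t` quantum minors. -/
def minorRel (k : Type) [Field k] (q : k) (n t : ℕ) :
    QMat k q n n → QMat k q n n → Prop :=
  fun a b => a ∈ minorSet k q n t ∧ b = 0

/-- The quantized function algebra `M^{r+1}_q(n) = M_q(n) / I^{r+1}_q` of rank `r`
matrices. -/
abbrev QMatRank (k : Type) [Field k] (q : k) (n r : ℕ) : Type :=
  RingQuot (minorRel k q n (r + 1))

/-- The quotient map `π : M_q(n) → M^{r+1}_q(n)`. -/
noncomputable def rankProj (k : Type) [Field k] (q : k) (n r : ℕ) :
    QMat k q n n →ₐ[k] QMatRank k q n r :=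
  RingQuot.mkAlgHom k (minorRel k q n (r + 1))

/-- The quantum minor `d = d_r`: the `r × r` quantum minor of `M_q(n)` on rows and
columns `1, ..., r`. -/
noncomputable def dMinor (k : Type) [Field k] (q : k) (n r : ℕ) (h : r ≤ n) :
    QMat k q n n :=
  qMinor k q n n r (fun a => Fin.castLE h a) (fun a => Fin.castLE h a)

/-- `q` is either generic (not a root of unity) or a primitive `m`-th root of unity for
some `m ≥ 1`. -/
def GenericOrRootOfUnity (k : Type) [Field k] (q : k) : Prop :=
  (∀ m : ℕ, 0 < m → q ^ m ≠ 1) ∨ ∃ m : ℕ, 0 < m ∧ IsPrimitiveRoot q m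

/-- The subalgebra `A_{n,r}` of `M_q(n)` generated by the `Z_{i,j}` with
`(i,j) ∉ {r+1, ..., n} × {r+1, ..., n}` (0-based: `i < r` or `j < r`). -/
def Asub (k : Type) [Field k] (q : k) (n r : ℕ) : Subalgebra k (QMat k q n n) :=
  Algebra.adjoin k
    {x | ∃ i j : Fin n, ((i : ℕ) < r ∨ (j : ℕ) < r) ∧ x = Zgen k q n n i j}

/-- The entries of `Z` satisfy the defining relations of quantized matrices. -/
structure IsQMatrix {k T : Type*} [Field k] [Ring T] [Algebra k T] (q : k) (Z : ℕ → ℕ → T) :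
    Prop where
  row : ∀ i j l, j < l → Z i j * Z i l = q • (Z i l * Z i j)
  col : ∀ i s j, i < s → Z i j * Z s j = q • (Z s j * Z i j)
  cross : ∀ i s j l, i < s → l < j → Z i j * Z s l = Z s l * Z i j
  diag : ∀ i s j l, i < s → j < l →
    Z i j * Z s l = Z s l * Z i j + (q - q⁻¹) • (Z i l * Z s j)

section QCommutation

variable {k T : Type*} [Field k] [Ring T] [Algebra k T] {q : k}

lemma qcomm_assoc {a b : T} {c : k} (h : a * b = c • (b * a)) (x : T) :
    a * (b * x) = c • (b * (a * x)) := by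
  rw [← mul_assoc, h, smul_mul_assoc, mul_assoc]

lemma qrow_aux (hq : q ≠ 0) {a d u v : T} (h1 : u * a = q • (a * u))
    (h2 : u * d = q⁻¹ • (d * u)) (h3 : v * a = q • (a * v)) (h4 : a * d = q ^ 2 • (d * a))
    (h5 : u * v = q • (v * u)) :
    a * u * ((a + d) * v) = q • ((a + d) * v * (a * u)) := by
  simp only [mul_assoc, add_mul, mul_add, qcomm_assoc h1, qcomm_assoc h2, qcomm_assoc h3,
    qcomm_assoc h4, h5, mul_smul_comm, smul_smul, smul_add]
  match_scalars <;> field_simp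

lemma qcol_aux {a b u : T} (h1 : u * a = q • (a * u)) (h2 : u * b = q • (b * u))
    (h3 : a * b = q • (b * a)) :
    a * u * (b * u) = q • (b * u * (a * u)) := by
  simp only [mul_assoc, qcomm_assoc h1, qcomm_assoc h2, qcomm_assoc h3, mul_smul_comm]

lemma qcross_aux (hq : q ≠ 0) {a d b u v : T} (h1 : v * a = q • (a * v))
    (h2 : v * d = q⁻¹ • (d * v)) (h3 : u * b = q • (b * u)) (h4 : a * b = q • (b * a))
    (h5 : d * b = q⁻¹ • (b * d)) (h6 : v * u = q • (u * v)) :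
    (a + d) * u * (b * v) = b * v * ((a + d) * u) := by
  simp only [mul_assoc, add_mul, mul_add, qcomm_assoc h1, qcomm_assoc h2, qcomm_assoc h3,
    qcomm_assoc h4, qcomm_assoc h5, h6, mul_smul_comm, smul_smul]
  match_scalars <;> field_simp

lemma qdiag_aux (hq : q ≠ 0) {a d b e u v : T} (h1 : u * b = q • (b * u))
    (h2 : u * e = q⁻¹ • (e * u)) (h3 : v * a = q • (a * v)) (h4 : v * b = q • (b * v))
    (h5 : a * b = q • (b * a)) (h6 : a * e = q • (e * a) + (q ^ 2 - 1) • (d * b))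
    (h7 : u * v = q • (v * u)) :
    a * u * ((b + e) * v) =
      (b + e) * v * (a * u) + (q - q⁻¹) • ((a + d) * v * (b * u)) := by
  have h6' : ∀ x, a * (e * x) = q • (e * (a * x)) + (q ^ 2 - 1) • (d * (b * x)) := fun x => by
    rw [← mul_assoc, h6, add_mul, smul_mul_assoc, smul_mul_assoc, mul_assoc, mul_assoc]
  simp only [mul_assoc, add_mul, mul_add, qcomm_assoc h1, qcomm_assoc h2, qcomm_assoc h3,
    qcomm_assoc h4, qcomm_assoc h5, h6', h7, mul_smul_comm, smul_smul, smul_add]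
  (match_scalars <;> field_simp); ring

lemma qcomm_sum {ι κ : Type*} (s : Finset ι) (t : Finset κ) (f : ι → T) (g : κ → T) (c : k)
    (h : ∀ i ∈ s, ∀ j ∈ t, f i * g j = c • (g j * f i)) :
    (∑ i ∈ s, f i) * (∑ j ∈ t, g j) = c • ((∑ j ∈ t, g j) * (∑ i ∈ s, f i)) := by
  rw [Finset.sum_mul_sum, Finset.sum_mul_sum, Finset.sum_comm, Finset.smul_sum]
  refine Finset.sum_congr rfl fun j hj => ?_
  rw [Finset.smul_sum]
  exact Finset.sum_congr rfl fun i hi => h i hi j hj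

lemma qcomm_sum_right {κ : Type*} (t : Finset κ) (f : T) (g : κ → T) (c : k)
    (h : ∀ j ∈ t, f * g j = c • (g j * f)) :
    f * (∑ j ∈ t, g j) = c • ((∑ j ∈ t, g j) * f) := by
  rw [Finset.mul_sum, Finset.sum_mul, Finset.smul_sum]
  exact Finset.sum_congr rfl h

end QCommutation

/-- Commutation relations between a row `t` and ratios `y s j = Z s j * (t j)⁻¹` of a quantum
matrix with that row. -/
structure RowData {k T : Type*} [Field k] [Ring T] [Algebra k T] (q : k) (t : ℕ → T)
    (y : ℕ → ℕ → T) : Prop where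
  tt : ∀ j l, j < l → t j * t l = q • (t l * t j)
  ty_le : ∀ s p j, j ≤ p → t p * y s j = q • (y s j * t p)
  ty_gt : ∀ s p j, p < j → t p * y s j = q⁻¹ • (y s j * t p)
  yrow : ∀ s j l, j < l → y s j * y s l = q ^ 2 • (y s l * y s j)
  ycol : ∀ s s' j, s < s' → y s j * y s' j = q • (y s' j * y s j)
  ycross : ∀ s s' j l, s < s' → l < j → y s j * y s' l = q⁻¹ • (y s' l * y s j)
  ydiag : ∀ s s' j l, s < s' → j < l →
    y s j * y s' l = q • (y s' l * y s j) + (q ^ 2 - 1) • (y s l * y s' j)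

/-- Add the row `t` on top of the matrix with ratios `y`. -/
def addRow {T : Type*} [Ring T] (t : ℕ → T) (y : ℕ → ℕ → T) : ℕ → ℕ → T
  | 0, l => t l
  | s + 1, l => (∑ j ∈ Finset.range (l + 1), y s j) * t l

namespace RowData

variable {k T : Type*} [Field k] [Ring T] [Algebra k T] {q : k} {t : ℕ → T} {y : ℕ → ℕ → T}

lemma t_psum (h : RowData q t y) (s : ℕ) {p l : ℕ} (hl : l ≤ p) :
    t p * (∑ j ∈ Finset.range (l + 1), y s j) =
      q • ((∑ j ∈ Finset.range (l + 1), y s j) * t p) :=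
  qcomm_sum_right _ _ _ _ fun j hj => h.ty_le s p j (by simp at hj; omega)

lemma t_gap (h : RowData q t y) (s p l : ℕ) :
    t p * (∑ j ∈ Finset.Ioc p l, y s j) = q⁻¹ • ((∑ j ∈ Finset.Ioc p l, y s j) * t p) :=
  qcomm_sum_right _ _ _ _ fun j hj => h.ty_gt s p j (by simp at hj; omega)

lemma psum_gap (h : RowData q t y) (s j l : ℕ) :
    (∑ i ∈ Finset.range (j + 1), y s i) * (∑ i ∈ Finset.Ioc j l, y s i) =
      q ^ 2 • ((∑ i ∈ Finset.Ioc j l, y s i) * (∑ i ∈ Finset.range (j + 1), y s i)) :=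
  qcomm_sum _ _ _ _ _ fun i hi i' hi' => h.yrow s i i' (by simp at hi hi'; omega)

lemma gap_psum (h : RowData q t y) {s s' : ℕ} (hs : s < s') (j l : ℕ) :
    (∑ i ∈ Finset.Ioc j l, y s i) * (∑ i ∈ Finset.range (j + 1), y s' i) =
      q⁻¹ • ((∑ i ∈ Finset.range (j + 1), y s' i) * (∑ i ∈ Finset.Ioc j l, y s i)) :=
  qcomm_sum _ _ _ _ _ fun i hi i' hi' => h.ycross s s' i i' hs (by simp at hi hi'; omega)

lemma psum_gap' (h : RowData q t y) {s s' : ℕ} (hs : s < s') (j l : ℕ) :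
    (∑ i ∈ Finset.range (j + 1), y s i) * (∑ i ∈ Finset.Ioc j l, y s' i) =
      q • ((∑ i ∈ Finset.Ioc j l, y s' i) * (∑ i ∈ Finset.range (j + 1), y s i)) +
      (q ^ 2 - 1) • ((∑ i ∈ Finset.Ioc j l, y s i) * (∑ i ∈ Finset.range (j + 1), y s' i)) := by
  rw [Finset.sum_mul_sum, Finset.sum_mul_sum, Finset.sum_mul_sum, Finset.sum_comm,
    Finset.smul_sum, Finset.smul_sum, ← Finset.sum_add_distrib]
  refine Finset.sum_congr rfl fun i hi => ?_
  rw [Finset.smul_sum, Finset.smul_sum, ← Finset.sum_add_distrib]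
  exact Finset.sum_congr rfl fun i' hi' => h.ydiag s s' i' i hs (by simp at hi hi'; omega)

lemma psum_psum (h : RowData q t y) (hq : q ≠ 0) {s s' : ℕ} (hs : s < s') (j : ℕ) :
    (∑ i ∈ Finset.range j, y s i) * (∑ i ∈ Finset.range j, y s' i) =
      q • ((∑ i ∈ Finset.range j, y s' i) * (∑ i ∈ Finset.range j, y s i)) := by
  induction j with
  | zero => simp
  | succ j ih =>
    rw [Finset.sum_range_succ, Finset.sum_range_succ]
    set a := ∑ i ∈ Finset.range j, y s i with ha
    set b := ∑ i ∈ Finset.range j, y s' i with hb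
    have h1 : y s j * b = q⁻¹ • (b * y s j) :=
      qcomm_sum_right _ _ _ _ fun i hi => h.ycross s s' j i hs (by simpa using hi)
    have h2 : a * y s' j = q • (y s' j * a) + (q ^ 2 - 1) • (y s j * b) := by
      rw [ha, hb, Finset.sum_mul, Finset.mul_sum, Finset.mul_sum, Finset.smul_sum,
        Finset.smul_sum, ← Finset.sum_add_distrib]
      exact Finset.sum_congr rfl fun i hi => h.ydiag s s' i j hs (by simpa using hi)
    rw [mul_add, add_mul, add_mul, ih, h2, h.ycol s s' j hs, h1]
    simp only [add_mul, mul_add, smul_add, smul_smul]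
    (match_scalars <;> field_simp); ring

lemma psum_split (y : ℕ → T) {j l : ℕ} (hjl : j < l) :
    ∑ i ∈ Finset.range (l + 1), y i =
      ∑ i ∈ Finset.range (j + 1), y i + ∑ i ∈ Finset.Ioc j l, y i := by
  rw [Finset.range_eq_Ico, ← Finset.sum_Ico_consecutive y (Nat.zero_le (j + 1))
    (show j + 1 ≤ l + 1 by omega), Finset.range_eq_Ico]
  congr 1
  exact Finset.sum_congr (by ext; simp) fun _ _ => rfl

/-- Adding a row on top produces a quantum matrix. -/
theorem isQMatrix_addRow (h : RowData q t y) (hq : q ≠ 0) : IsQMatrix q (addRow t y) where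
  row i j l hjl := by
    cases i with
    | zero => exact h.tt j l hjl
    | succ s =>
      simp only [addRow]
      rw [psum_split (y s) hjl]
      exact qrow_aux hq (h.t_psum s le_rfl) (h.t_gap s j l) (h.t_psum s hjl.le)
        (h.psum_gap s j l) (h.tt j l hjl)
  col i s j his := by
    obtain ⟨s, rfl⟩ : ∃ s', s = s' + 1 := ⟨s - 1, by omega⟩
    cases i with
    | zero =>
      simp only [addRow]
      rw [← mul_assoc, h.t_psum s le_rfl, smul_mul_assoc]
    | succ i =>
      exact qcol_aux (h.t_psum i le_rfl) (h.t_psum s le_rfl) (h.psum_psum hq (by omega) _)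
  cross i s j l his hlj := by
    obtain ⟨s, rfl⟩ : ∃ s', s = s' + 1 := ⟨s - 1, by omega⟩
    cases i with
    | zero =>
      simp only [addRow]
      rw [← mul_assoc, h.t_psum s hlj.le, smul_mul_assoc, mul_assoc, mul_assoc, h.tt l j hlj,
        mul_smul_comm]
    | succ i =>
      simp only [addRow]
      rw [psum_split (y i) hlj]
      exact qcross_aux hq (h.t_psum i le_rfl) (h.t_gap i l j) (h.t_psum s hlj.le)
        (h.psum_psum hq (by omega) _) (h.gap_psum (by omega) l j) (h.tt l j hlj)
  diag i s j l his hjl := by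
    obtain ⟨s, rfl⟩ : ∃ s', s = s' + 1 := ⟨s - 1, by omega⟩
    cases i with
    | zero =>
      simp only [addRow]
      rw [psum_split (y s) hjl]
      simp only [mul_assoc, add_mul, mul_add, qcomm_assoc (h.t_psum s (le_refl j)),
        qcomm_assoc (h.t_gap s j l), qcomm_assoc (h.t_psum s hjl.le), h.tt j l hjl,
        mul_smul_comm, smul_smul]
      (match_scalars <;> field_simp); ring
    | succ i =>
      simp only [addRow]
      rw [psum_split (y i) hjl, psum_split (y s) hjl]
      exact qdiag_aux hq (h.t_psum s le_rfl) (h.t_gap s j l) (h.t_psum i hjl.le)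
        (h.t_psum s hjl.le) (h.psum_psum hq (by omega) _) (h.psum_gap' (by omega) j l)
        (h.tt j l hjl)

end RowData

/-- `b'` is the inverse of `b`, or both vanish. -/
def IsInvOrZero {T : Type*} [Ring T] (b b' : T) : Prop :=
  (b * b' = 1 ∧ b' * b = 1) ∨ (b = 0 ∧ b' = 0)

section QCommutation

variable {k T : Type*} [Field k] [Ring T] [Algebra k T] {q : k}

lemma qcomm_symm {a b : T} {c : k} (hc : c ≠ 0) (h : a * b = c • (b * a)) :
    b * a = c⁻¹ • (a * b) := by
  rw [h, smul_smul, inv_mul_cancel₀ hc, one_smul]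

lemma IsInvOrZero.qcomm_right {a b b' : T} {c : k} (hc : c ≠ 0) (hb : IsInvOrZero b b')
    (h : a * b = c • (b * a)) : a * b' = c⁻¹ • (b' * a) := by
  rcases hb with ⟨h1, h2⟩ | ⟨rfl, rfl⟩
  · calc a * b' = b' * (b * a) * b' := by rw [← mul_assoc, h2, one_mul]
      _ = b' * (c⁻¹ • (a * b)) * b' := by rw [qcomm_symm hc h]
      _ = c⁻¹ • (b' * a) := by
        rw [mul_smul_comm, smul_mul_assoc, mul_assoc, mul_assoc, h1, mul_one]
  · simp

lemma IsInvOrZero.qcomm_left {a a' b : T} {c : k} (hc : c ≠ 0) (ha : IsInvOrZero a a')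
    (h : a * b = c • (b * a)) : a' * b = c⁻¹ • (b * a') := by
  have := ha.qcomm_right (inv_ne_zero hc) (qcomm_symm hc h)
  rw [inv_inv] at this
  exact qcomm_symm hc this

end QCommutation

/-- `q`-commuting elements `t i j`, each invertible or zero, with (pseudo-)inverses `p i j`. -/
structure TorusData {k T : Type*} [Field k] [Ring T] [Algebra k T] (q : k) (t p : ℕ → ℕ → T) :
    Prop where
  row : ∀ i j l, j < l → t i j * t i l = q • (t i l * t i j)
  col : ∀ i s j, i < s → t i j * t s j = q • (t s j * t i j)
  comm : ∀ i s j l, i ≠ s → j ≠ l → t i j * t s l = t s l * t i j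
  inv : ∀ i j, IsInvOrZero (t i j) (p i j)
  down : ∀ i j, t i j = 0 → t (i + 1) j = 0

/-- The entry in row `s` and column `l` of the path matrix: the sum of the weights of the
lattice paths from row `s` to column `l` in the upper left quadrant. -/
def pathEntry {T : Type*} [Ring T] : ℕ → (ℕ → ℕ → T) → (ℕ → ℕ → T) → ℕ → T
  | 0, t, _, l => t 0 l
  | s + 1, t, p, l =>
    (∑ j ∈ Finset.range (l + 1),
      pathEntry s (fun i => t (i + 1)) (fun i => p (i + 1)) j * p 0 j) * t 0 l

section PathMatrix

variable {k T : Type*} [Field k] [Ring T] [Algebra k T] {q : k}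

lemma qcomm_pathEntry {w : T} {g : ℕ → k} (hg : ∀ l, g l ≠ 0) (s : ℕ) :
    ∀ (t p : ℕ → ℕ → T), (∀ i l, w * t i l = g l • (t i l * w)) →
      (∀ i l, w * p i l = (g l)⁻¹ • (p i l * w)) →
      ∀ l, w * pathEntry s t p l = g l • (pathEntry s t p l * w) := by
  induction s with
  | zero => intro t p ht _ l; exact ht 0 l
  | succ s ih =>
    intro t p ht hp l
    simp only [pathEntry]
    have h1 : w * (∑ j ∈ Finset.range (l + 1),
        pathEntry s (fun i => t (i + 1)) (fun i => p (i + 1)) j * p 0 j) =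
        (1 : k) • ((∑ j ∈ Finset.range (l + 1),
        pathEntry s (fun i => t (i + 1)) (fun i => p (i + 1)) j * p 0 j) * w) := by
      refine qcomm_sum_right _ _ _ _ fun j _ => ?_
      rw [qcomm_assoc (ih _ _ (fun i => ht (i + 1)) (fun i => hp (i + 1)) j), hp 0 j,
        mul_smul_comm, smul_smul, mul_inv_cancel₀ (hg j), mul_assoc]
    rw [qcomm_assoc h1, ht 0 l, one_smul, mul_smul_comm, mul_assoc]

lemma TorusData.shift {t p : ℕ → ℕ → T} (h : TorusData q t p) :
    TorusData q (fun i => t (i + 1)) (fun i => p (i + 1)) where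
  row i := h.row (i + 1)
  col i s j his := h.col (i + 1) (s + 1) j (by omega)
  comm i s j l his := h.comm (i + 1) (s + 1) j l (by omega)
  inv i := h.inv (i + 1)
  down i := h.down (i + 1)

lemma pathEntry_eq_zero {t p : ℕ → ℕ → T} {j : ℕ} (hj : t 0 j = 0)
    (s : ℕ) : pathEntry s t p j = 0 := by
  cases s <;> simp [pathEntry, hj]

/-- Ratios between the lower rows of a path matrix and its top row. -/
lemma TorusData.rowData {t p : ℕ → ℕ → T} (h : TorusData q t p) (hq : q ≠ 0)
    (hZ : IsQMatrix q fun s l => pathEntry s (fun i => t (i + 1)) (fun i => p (i + 1)) l) :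
    RowData q (t 0)
      (fun s j => pathEntry s (fun i => t (i + 1)) (fun i => p (i + 1)) j * p 0 j) := by
  set Z := fun s l => pathEntry s (fun i => t (i + 1)) (fun i => p (i + 1)) l with hZdef
  change RowData q (t 0) (fun s j => Z s j * p 0 j)
  have tZ : ∀ a s l, t 0 a * Z s l = (if l = a then q else 1) • (Z s l * t 0 a) := by
    intro a s l
    have key : ∀ i l, t 0 a * t (i + 1) l = (if l = a then q else 1) • (t (i + 1) l * t 0 a) := by
      intro i l
      split_ifs with hl
      · rw [hl, h.col 0 (i + 1) a (by omega)]
      · rw [h.comm 0 (i + 1) a l (by omega) (fun e => hl e.symm), one_smul]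
    have hg : ∀ l, (if l = a then q else (1 : k)) ≠ 0 := by
      intro l; split_ifs <;> simp [hq]
    exact qcomm_pathEntry hg s _ _ key
      (fun i l => (h.inv (i + 1) l).qcomm_right (hg l) (key i l)) l
  have tZ_eq : ∀ a s, t 0 a * Z s a = q • (Z s a * t 0 a) := fun a s => by
    simpa using tZ a s a
  have tZ_ne : ∀ a s l, l ≠ a → t 0 a * Z s l = (1 : k) • (Z s l * t 0 a) := fun a s l hl => by
    simpa [hl] using tZ a s l
  have pZ_eq : ∀ a s, p 0 a * Z s a = q⁻¹ • (Z s a * p 0 a) := fun a s =>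
    (h.inv 0 a).qcomm_left hq (tZ_eq a s)
  have pZ_ne : ∀ a s l, l ≠ a → p 0 a * Z s l = Z s l * p 0 a := fun a s l hl => by
    simpa using (h.inv 0 a).qcomm_left one_ne_zero (tZ_ne a s l hl)
  have tp_lt : ∀ a b, a < b → t 0 a * p 0 b = q⁻¹ • (p 0 b * t 0 a) := fun a b hab =>
    (h.inv 0 b).qcomm_right hq (h.row 0 a b hab)
  have tp_gt : ∀ a b, b < a → t 0 a * p 0 b = q • (p 0 b * t 0 a) := fun a b hab => by
    simpa using (h.inv 0 b).qcomm_right (inv_ne_zero hq) (qcomm_symm hq (h.row 0 b a hab))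
  have tp_eq : ∀ a, t 0 a * p 0 a = p 0 a * t 0 a := fun a => by
    rcases h.inv 0 a with ⟨h1, h2⟩ | ⟨h1, h2⟩ <;> rw [h1, h2]
  have pp : ∀ a b, a < b → p 0 a * p 0 b = q • (p 0 b * p 0 a) := fun a b hab => by
    simpa using (h.inv 0 a).qcomm_left (inv_ne_zero hq) (tp_lt a b hab)
  have pZ_eq' := fun a s => qcomm_assoc (pZ_eq a s)
  have pZ_ne' : ∀ a s l, l ≠ a → ∀ x, p 0 a * (Z s l * x) = Z s l * (p 0 a * x) :=
    fun a s l hl x => by rw [← mul_assoc, pZ_ne a s l hl, mul_assoc]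
  refine ⟨h.row 0, ?_, ?_, ?_, ?_, ?_, ?_⟩
  · intro s a j hja
    rcases hja.eq_or_lt with rfl | hja
    · rw [qcomm_assoc (tZ_eq j s), tp_eq, mul_assoc]
    · rw [qcomm_assoc (tZ_ne a s j hja.ne), tp_gt a j hja, one_smul, mul_smul_comm, mul_assoc]
  · intro s a j hja
    rw [qcomm_assoc (tZ_ne a s j hja.ne'), tp_lt a j hja, one_smul, mul_smul_comm, mul_assoc]
  · intro s j l hjl
    simp only [mul_assoc, pZ_ne' j s l hjl.ne', pZ_ne' l s j hjl.ne]
    rw [pp j l hjl, ← mul_assoc, hZ.row s j l hjl]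
    simp only [mul_smul_comm, smul_mul_assoc, smul_smul, mul_assoc, sq]
  · intro s s' j hs
    simp only [mul_assoc, pZ_eq' j]
    rw [mul_smul_comm, mul_smul_comm, ← mul_assoc, hZ.col s s' j hs]
    simp only [smul_mul_assoc, smul_smul, mul_assoc, mul_comm]
  · intro s s' j l hs hlj
    simp only [mul_assoc, pZ_ne' j s' l hlj.ne, pZ_ne' l s j hlj.ne']
    rw [← mul_assoc, hZ.cross s s' j l hs hlj, qcomm_symm hq (pp l j hlj), mul_smul_comm,
      mul_assoc]
  · intro s s' j l hs hjl
    simp only [mul_assoc, pZ_ne' j s' l hjl.ne', pZ_ne' l s j hjl.ne, pZ_ne' l s' j hjl.ne]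
    rw [← mul_assoc, hZ.diag s s' j l hs hjl, pp j l hjl]
    simp only [mul_smul_comm, smul_mul_assoc, smul_smul, mul_assoc, add_mul, smul_add]
    match_scalars <;> field_simp

theorem TorusData.isQMatrix (hq : q ≠ 0) (N : ℕ) :
    ∀ (t p : ℕ → ℕ → T), TorusData q t p → (∀ i, N ≤ i → ∀ j, t i j = 0) →
      IsQMatrix q fun s l => pathEntry s t p l := by
  induction N with
  | zero =>
    intro t p h h0
    have : ∀ s l, pathEntry s t p l = 0 := fun s l =>
      pathEntry_eq_zero (h0 0 (le_refl 0) l) s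
    constructor <;> intros <;> simp [this]
  | succ N ih =>
    intro t p h h0
    have key :=
      (h.rowData hq (ih _ _ h.shift fun i hi => h0 (i + 1) (by omega))).isQMatrix_addRow hq
    convert key using 1
    funext s l
    cases s <;> rfl

end PathMatrix

lemma pathEntry_sub_mem {T : Type*} [Ring T] (S : Subring T) (s : ℕ) :
    ∀ (t p : ℕ → ℕ → T), (∀ i j, IsInvOrZero (t i j) (p i j)) →
      (∀ i j, t i j = 0 → t (i + 1) j = 0) →
      ∀ l, (∀ i j, i < s ∨ (i = s ∧ j < l) → t i j ∈ S ∧ p i j ∈ S) →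
      pathEntry s t p l - t s l ∈ S := by
  induction s with
  | zero => intro t p _ _ l _; simp [pathEntry, S.zero_mem]
  | succ s ih =>
    intro t p hinv hdown l hS
    have hmem : ∀ j ≤ l, pathEntry s (fun i => t (i + 1)) (fun i => p (i + 1)) j -
        t (s + 1) j ∈ S := fun j hj =>
      ih (fun i => t (i + 1)) (fun i => p (i + 1)) (fun i => hinv (i + 1))
        (fun i => hdown (i + 1)) j fun i j' hi => hS (i + 1) j' (by omega)
    have h0 := hS 0 l (by omega)
    simp only [pathEntry]
    rw [Finset.sum_range_succ, add_mul, add_sub_assoc, Finset.sum_mul]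
    refine S.add_mem (S.sum_mem fun j hj => ?_) ?_
    · have hj : j < l := by simpa using hj
      have h1 := S.add_mem (hmem j hj.le) (hS (s + 1) j (by omega)).1
      rw [sub_add_cancel] at h1
      exact S.mul_mem (S.mul_mem h1 (hS 0 j (by omega)).2) h0.1
    · have h1 := hmem l le_rfl
      rcases hinv 0 l with ⟨_, h2⟩ | ⟨h2, _⟩
      · rwa [mul_assoc, h2, mul_one]
      · have : ∀ i, t i l = 0 := fun i => by
          induction i with
          | zero => exact h2
          | succ i ih => exact hdown i l ih
        rw [h2, this, mul_zero, sub_zero]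
        exact S.zero_mem

/-- The representation of the quantum matrix algebra attached to a quantum matrix. -/
noncomputable def IsQMatrix.hom {k : Type} [Field k] {q : k} {T : Type*} [Ring T] [Algebra k T]
    {Z : ℕ → ℕ → T} (h : IsQMatrix q Z) (n r : ℕ) : QMat k q n r →ₐ[k] T :=
  RingQuot.liftAlgHom k ⟨FreeAlgebra.lift k fun x : Fin n × Fin r => Z x.1 x.2, by
    intro x y hxy
    induction hxy with
    | row i j l hjl => simpa using h.row i j l hjl
    | col i s j his => simpa using h.col i s j his
    | cross i s j l his hlj => simpa using h.cross i s j l his hlj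
    | diag i s j l his hjl => simpa using h.diag i s j l his hjl⟩

lemma IsQMatrix.hom_Zgen {k : Type} [Field k] {q : k} {T : Type*} [Ring T] [Algebra k T]
    {Z : ℕ → ℕ → T} (h : IsQMatrix q Z) (n r : ℕ) (i : Fin n) (j : Fin r) :
    h.hom n r (Zgen k q n r i j) = Z i j := by
  simp [IsQMatrix.hom, Zgen]

/-- The product of the values of `Z` along a word. -/
def wordProd {α T : Type*} [Ring T] (Z : α → T) (l : List α) : T := (l.map Z).prod

section Straightening

variable {α : Type*} [LinearOrder α]

lemma List.exists_descent_of_not_pairwise (l : List α) (h : ¬ l.Pairwise (· ≤ ·)) :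
    ∃ u a b v, l = u ++ a :: b :: v ∧ b < a := by
  rw [← List.isChain_iff_pairwise] at h
  induction l with
  | nil => simp at h
  | cons a l ih =>
    cases l with
    | nil => simp at h
    | cons b l =>
      by_cases hab : b < a
      · exact ⟨[], a, b, l, rfl, hab⟩
      · rw [List.isChain_cons_cons] at h
        obtain ⟨u, a', b', v, h1, h2⟩ := ih fun h' => h ⟨not_lt.mp hab, h'⟩
        exact ⟨a :: u, a', b', v, by rw [h1, List.cons_append], h2⟩

variable {k T : Type*} [Field k] [Ring T] [Algebra k T] [Finite α]

/-- If any descent of a word can be rewritten by lexicographically smaller words, then the sorted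
words span the subalgebra generated by the letters. -/
theorem adjoin_le_span_sorted (Z : α → T)
    (hZ : ∀ a b, b < a → ∃ (c c' : k) (a' b' : α), a' < a ∧
      Z a * Z b = c • (Z b * Z a) + c' • (Z a' * Z b')) :
    Subalgebra.toSubmodule (Algebra.adjoin k (Set.range Z)) ≤
      Submodule.span k (Set.range fun l : {l : List α // l.Pairwise (· ≤ ·)} =>
        wordProd Z l) := by
  set W := Submodule.span k (Set.range fun l : {l : List α // l.Pairwise (· ≤ ·)} =>
    wordProd Z l)
  have key : ∀ N : ℕ, ∀ l : {l : List α // l.length = N}, wordProd Z (l : List α) ∈ W := by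
    intro N
    have : Finite {l : List α // l.length = N} := by
      have := Fintype.ofFinite α
      exact inferInstanceAs (Finite (List.Vector α N))
    intro l
    induction l using WellFoundedLT.induction with
    | ind l ih =>
    by_cases hl : (l : List α).Pairwise (· ≤ ·)
    · exact Submodule.subset_span ⟨⟨l, hl⟩, rfl⟩
    · obtain ⟨u, a, b, v, hl1, hab⟩ := List.exists_descent_of_not_pairwise _ hl
      obtain ⟨c, c', a', b', ha', hrel⟩ := hZ a b hab
      have hlen : (u ++ a :: b :: v).length = N := hl1 ▸ l.2
      have hlt : ∀ x y, x < a → (u ++ x :: y :: v) < (u ++ a :: b :: v) := fun x y hx =>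
        List.Lex.append_left _ (List.Lex.rel hx) u
      have hmem : ∀ x y, x < a → wordProd Z (u ++ x :: y :: v) ∈ W := fun x y hx =>
        ih ⟨u ++ x :: y :: v, by simpa using hlen⟩ (by
          change (u ++ x :: y :: v) < (l : List α)
          rw [hl1]; exact hlt x y hx)
      have hexp : wordProd Z (l : List α) = c • wordProd Z (u ++ b :: a :: v) +
          c' • wordProd Z (u ++ a' :: b' :: v) := by
        have : ∀ x y, wordProd Z (u ++ x :: y :: v) =
            wordProd Z u * (Z x * Z y) * wordProd Z v := fun x y => by
          simp [wordProd, mul_assoc]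
        rw [hl1, this, this, this, hrel]
        simp [mul_add, add_mul]
      rw [hexp]
      exact W.add_mem (W.smul_mem _ (hmem b a hab)) (W.smul_mem _ (hmem a' b' ha'))
  rw [Algebra.adjoin_eq_span, Submodule.span_le]
  intro x hx
  obtain ⟨l, hl, rfl⟩ := Submonoid.exists_list_of_mem_closure hx
  obtain ⟨l', rfl⟩ : ∃ l' : List α, l'.map Z = l := by
    clear hx
    induction l with
    | nil => exact ⟨[], rfl⟩
    | cons y l ih =>
      obtain ⟨l', rfl⟩ := ih fun z hz => hl z (List.mem_cons_of_mem _ hz)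
      obtain ⟨a, rfl⟩ := hl y List.mem_cons_self
      exact ⟨a :: l', rfl⟩
  exact key l'.length ⟨l', rfl⟩

end Straightening

/-- The positions `(i, j)` in an `n × n` matrix with `i < r` or `j < r`, ordered
lexicographically. -/
abbrev HookPos (n r : ℕ) : Type :=
  {x : Fin n ×ₗ Fin n // ((ofLex x).1 : ℕ) < r ∨ ((ofLex x).2 : ℕ) < r}

lemma HookPos.lt_iff {n r : ℕ} (a b : HookPos n r) :
    a < b ↔ (ofLex a.1).1 < (ofLex b.1).1 ∨
      ((ofLex a.1).1 = (ofLex b.1).1 ∧ (ofLex a.1).2 < (ofLex b.1).2) := by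
  rw [← Subtype.coe_lt_coe, Prod.Lex.lt_iff]

section

variable {k : Type} [Field k] {q : k}

lemma Zgen_row (n r : ℕ) (i : Fin n) (j l : Fin r) (h : j < l) :
    Zgen k q n r i j * Zgen k q n r i l = q • (Zgen k q n r i l * Zgen k q n r i j) := by
  simpa [Zgen] using RingQuot.mkAlgHom_rel k (QMatRel.row (q := q) i j l h)

lemma Zgen_col (n r : ℕ) (i s : Fin n) (j : Fin r) (h : i < s) :
    Zgen k q n r i j * Zgen k q n r s j = q • (Zgen k q n r s j * Zgen k q n r i j) := by
  simpa [Zgen] using RingQuot.mkAlgHom_rel k (QMatRel.col (q := q) i s j h)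

lemma Zgen_cross (n r : ℕ) (i s : Fin n) (j l : Fin r) (h1 : i < s) (h2 : l < j) :
    Zgen k q n r i j * Zgen k q n r s l = Zgen k q n r s l * Zgen k q n r i j := by
  simpa [Zgen] using RingQuot.mkAlgHom_rel k (QMatRel.cross (q := q) i s j l h1 h2)

lemma Zgen_diag (n r : ℕ) (i s : Fin n) (j l : Fin r) (h1 : i < s) (h2 : j < l) :
    Zgen k q n r i j * Zgen k q n r s l = Zgen k q n r s l * Zgen k q n r i j +
      (q - q⁻¹) • (Zgen k q n r i l * Zgen k q n r s j) := by
  simpa [Zgen] using RingQuot.mkAlgHom_rel k (QMatRel.diag (q := q) i s j l h1 h2)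

/-- The generator of the hook algebra at a given position. -/
noncomputable def hookGen (k : Type) [Field k] (q : k) (n r : ℕ) (a : HookPos n r) :
    QMat k q n n :=
  Zgen k q n n (ofLex a.1).1 (ofLex a.1).2

lemma eq_one_smul_add_neg_smul {T : Type*} [Ring T] [Algebra k T] {x y z : T} {c : k}
    (h : x = y + c • z) : y = (1 : k) • x + (-c) • z := by
  rw [h, one_smul, neg_smul, add_neg_cancel_right]

lemma hookGen_straighten (hq : q ≠ 0) (n r : ℕ) (a b : HookPos n r) (h : b < a) :
    ∃ (c c' : k) (a' b' : HookPos n r), a' < a ∧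
      hookGen k q n r a * hookGen k q n r b =
        c • (hookGen k q n r b * hookGen k q n r a) +
        c' • (hookGen k q n r a' * hookGen k q n r b') := by
  have hab := h
  obtain ⟨⟨s, t⟩, ha⟩ := a
  obtain ⟨⟨i, j⟩, hb⟩ := b
  rw [HookPos.lt_iff] at h
  change ((s : ℕ) < r ∨ (t : ℕ) < r) at ha
  change ((i : ℕ) < r ∨ (j : ℕ) < r) at hb
  change i < s ∨ (i = s ∧ j < t) at h
  change ∃ (c c' : k) (a' b' : HookPos n r), _ ∧ Zgen k q n n s t * Zgen k q n n i j =
      c • (Zgen k q n n i j * Zgen k q n n s t) + c' • _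
  rcases h with h | ⟨rfl, h⟩
  · rcases lt_trichotomy j t with hj | rfl | hj
    · refine ⟨1, -(q - q⁻¹), ⟨toLex (i, t), ?_⟩, ⟨toLex (s, j), ?_⟩, ?_, ?_⟩
      · change (i : ℕ) < r ∨ (t : ℕ) < r
        have : (i : ℕ) < s := h
        omega
      · change (s : ℕ) < r ∨ (j : ℕ) < r
        have : (j : ℕ) < t := hj
        omega
      · rw [HookPos.lt_iff]
        exact Or.inl h
      · change _ = (1 : k) • _ + (-(q - q⁻¹)) • (Zgen k q n n i t * Zgen k q n n s j)
        exact eq_one_smul_add_neg_smul (T := QMat k q n n) (c := q - q⁻¹)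
          (Zgen_diag (k := k) (q := q) n n i s j t h hj)
    · refine ⟨q⁻¹, 0, _, ⟨toLex (i, j), hb⟩, hab, ?_⟩
      rw [Zgen_col n n i s j h, smul_smul, inv_mul_cancel₀ hq]
      simp
    · refine ⟨1, 0, _, ⟨toLex (i, j), hb⟩, hab, ?_⟩
      rw [Zgen_cross n n i s j t h hj]
      simp
  · refine ⟨q⁻¹, 0, _, ⟨toLex (i, j), hb⟩, hab, ?_⟩
    rw [Zgen_row n n i j t h, smul_smul, inv_mul_cancel₀ hq]
    simp

lemma Asub_eq_adjoin_range (n r : ℕ) :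
    Asub k q n r = Algebra.adjoin k (Set.range (hookGen k q n r)) := by
  rw [Asub]
  congr 1
  ext x
  constructor
  · rintro ⟨i, j, h, rfl⟩
    exact ⟨⟨toLex (i, j), h⟩, rfl⟩
  · rintro ⟨a, rfl⟩
    exact ⟨_, _, a.2, rfl⟩

/-- Sorted monomials span the hook algebra. -/
theorem Asub_le_span_sorted (hq : q ≠ 0) (n r : ℕ) :
    Subalgebra.toSubmodule (Asub k q n r) ≤
      Submodule.span k (Set.range fun l : {l : List (HookPos n r) // l.Pairwise (· ≤ ·)} =>
        wordProd (hookGen k q n r) l) := by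
  rw [Asub_eq_adjoin_range]
  exact adjoin_le_span_sorted _ fun a b => hookGen_straighten hq n r a b

end

/-- The matrix `u` is the leading coefficient of `x`, in degree `γ`. -/
def HasLead {k Γ ι : Type*} [Semiring k] [LinearOrder Γ]
    (x : Matrix ι ι (AddMonoidAlgebra k Γ)) (γ : Γ) (u : Matrix ι ι k) : Prop :=
  (∀ i j, (x i j).coeff γ = u i j) ∧ ∀ δ, γ < δ → ∀ i j, (x i j).coeff δ = 0

section LeadingTerms

variable {k Γ ι : Type*} [Field k] [LinearOrder Γ]

lemma AddMonoidAlgebra.coeff_mul_add [AddCommMonoid Γ] [IsOrderedCancelAddMonoid Γ]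
    {f g : AddMonoidAlgebra k Γ} {γ δ : Γ}
    (hf : ∀ γ', γ < γ' → f.coeff γ' = 0) (hg : ∀ δ', δ < δ' → g.coeff δ' = 0) :
    (f * g).coeff (γ + δ) = f.coeff γ * g.coeff δ := by
  rw [coeff_mul, Finsupp.sum, Finset.sum_eq_single γ]
  · rw [Finsupp.sum, Finset.sum_eq_single δ]
    · simp
    · intro b _ hb
      simp [hb]
    · intro h
      simp [Finsupp.notMem_support_iff.mp h]
  · intro a ha haγ
    refine Finset.sum_eq_zero fun b hb => if_neg fun hab => ?_
    have ha' : a ≤ γ := not_lt.mp fun h => Finsupp.mem_support_iff.mp ha (hf a h)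
    have hb' : b ≤ δ := not_lt.mp fun h => Finsupp.mem_support_iff.mp hb (hg b h)
    exact (add_lt_add_of_lt_of_le (lt_of_le_of_ne ha' haγ) hb').ne hab
  · intro h
    simp [Finsupp.notMem_support_iff.mp h]

lemma AddMonoidAlgebra.coeff_mul_eq_zero [AddCommMonoid Γ] [IsOrderedCancelAddMonoid Γ]
    {f g : AddMonoidAlgebra k Γ} {γ δ ε : Γ}
    (hf : ∀ γ', γ < γ' → f.coeff γ' = 0) (hg : ∀ δ', δ < δ' → g.coeff δ' = 0)
    (h : γ + δ < ε) : (f * g).coeff ε = 0 := by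
  rw [coeff_mul]
  refine Finset.sum_eq_zero fun a ha => Finset.sum_eq_zero fun b hb => if_neg fun hab => ?_
  have ha' : a ≤ γ := not_lt.mp fun h => Finsupp.mem_support_iff.mp ha (hf a h)
  have hb' : b ≤ δ := not_lt.mp fun h => Finsupp.mem_support_iff.mp hb (hg b h)
  exact (lt_of_le_of_lt (add_le_add ha' hb') h).ne hab

lemma HasLead.mul [AddCommMonoid Γ] [IsOrderedCancelAddMonoid Γ] [Fintype ι]
    {x y : Matrix ι ι (AddMonoidAlgebra k Γ)} {γ δ : Γ}
    {u v : Matrix ι ι k} (hx : HasLead x γ u) (hy : HasLead y δ v) :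
    HasLead (x * y) (γ + δ) (u * v) := by
  refine ⟨fun i j => ?_, fun ε hε i j => ?_⟩
  · rw [Matrix.mul_apply, Matrix.mul_apply, AddMonoidAlgebra.coeff_sum, Finsupp.finsetSum_apply]
    refine Finset.sum_congr rfl fun l _ => ?_
    rw [AddMonoidAlgebra.coeff_mul_add (fun ε h => hx.2 ε h i l) (fun ε h => hy.2 ε h l j),
      hx.1, hy.1]
  · rw [Matrix.mul_apply, AddMonoidAlgebra.coeff_sum, Finsupp.finsetSum_apply]
    exact Finset.sum_eq_zero fun l _ => AddMonoidAlgebra.coeff_mul_eq_zero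
      (fun ε h => hx.2 ε h i l) (fun ε h => hy.2 ε h l j) hε

lemma HasLead.one [AddCommMonoid Γ] [DecidableEq ι] :
    HasLead (1 : Matrix ι ι (AddMonoidAlgebra k Γ)) 0 (1 : Matrix ι ι k) := by
  refine ⟨fun i j => ?_, fun ε hε i j => ?_⟩
  · rw [Matrix.one_apply, Matrix.one_apply]
    split_ifs <;> simp
  · rw [Matrix.one_apply]
    split_ifs
    · rw [AddMonoidAlgebra.one_def, AddMonoidAlgebra.coeff_single,
        Finsupp.single_eq_of_ne hε.ne']
    · rfl

/-- Words in elements with invertible leading coefficients have invertible leading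
coefficients. -/
lemma exists_hasLead_wordProd [AddCommMonoid Γ] [IsOrderedCancelAddMonoid Γ] [Fintype ι]
    [DecidableEq ι] {α : Type*}
    (Z : α → Matrix ι ι (AddMonoidAlgebra k Γ)) (e : α → Γ)
    (hZ : ∀ a, ∃ u, IsUnit u ∧ HasLead (Z a) (e a) u) (l : List α) :
    ∃ u, IsUnit u ∧ HasLead (wordProd Z l) ((l.map e).sum) u := by
  induction l with
  | nil => exact ⟨1, isUnit_one, HasLead.one⟩
  | cons a l ih =>
    obtain ⟨u, hu, hu'⟩ := ih
    obtain ⟨v, hv, hv'⟩ := hZ a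
    exact ⟨v * u, hv.mul hu, by simpa [wordProd] using hv'.mul hu'⟩

lemma linearIndependent_of_hasLead {κ : Type*}
    (x : κ → Matrix ι ι (AddMonoidAlgebra k Γ)) (e : κ → Γ) (he : Function.Injective e)
    (hx : ∀ a, ∃ u, u ≠ 0 ∧ HasLead (x a) (e a) u) : LinearIndependent k x := by
  rw [linearIndependent_iff]
  intro c hc
  by_contra hne
  obtain ⟨a, ha, hmax⟩ := c.support.exists_max_image e (Finsupp.support_nonempty_iff.mpr hne)
  obtain ⟨u, hu, hlead⟩ := hx a
  refine hu ?_
  ext i j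
  have h1 : ((Finsupp.linearCombination k x c) i j).coeff (e a) = 0 := by rw [hc]; rfl
  rw [Finsupp.linearCombination_apply, Finsupp.sum, Matrix.sum_apply,
    AddMonoidAlgebra.coeff_sum, Finsupp.finsetSum_apply, Finset.sum_eq_single a] at h1
  · rw [Matrix.smul_apply, AddMonoidAlgebra.coeff_smul_apply, hlead.1, smul_eq_mul,
      mul_eq_zero] at h1
    exact h1.resolve_left (Finsupp.mem_support_iff.mp ha)
  · intro b hb hba
    obtain ⟨v, _, hv⟩ := hx b
    rw [Matrix.smul_apply, AddMonoidAlgebra.coeff_smul_apply,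
      hv.2 (e a) (lt_of_le_of_ne (hmax b hb) fun h => hba (he h)), smul_zero]
  · exact fun h => absurd ha h

end LeadingTerms

lemma injOn_of_linearIndependent_comp {k V W κ : Type*} [Field k] [AddCommGroup V] [Module k V]
    [AddCommGroup W] [Module k W] (f : V →ₗ[k] W) (v : κ → V)
    (h : LinearIndependent k (f ∘ v)) {x : V} (hx : x ∈ Submodule.span k (Set.range v))
    (hfx : f x = 0) : x = 0 := by
  obtain ⟨c, rfl⟩ := Finsupp.mem_span_range_iff_exists_finsupp.mp hx
  rw [map_finsuppSum] at hfx
  simp only [map_smul] at hfx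
  have := linearIndependent_iff.mp h c (by simpa [Finsupp.linearCombination_apply] using hfx)
  simp [this]

section MonomialMatrices

variable {k Γ ι : Type*} [Field k]

/-- The matrix `u` times the monomial of degree `γ`. -/
noncomputable def monomialMatrix (γ : Γ) (u : Matrix ι ι k) :
    Matrix ι ι (AddMonoidAlgebra k Γ) :=
  u.map (AddMonoidAlgebra.single γ)

lemma monomialMatrix_mul [Fintype ι] [AddMonoid Γ] (γ δ : Γ) (u v : Matrix ι ι k) :
    monomialMatrix γ u * monomialMatrix δ v = monomialMatrix (γ + δ) (u * v) := by
  ext1 i j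
  simp only [monomialMatrix, Matrix.mul_apply, Matrix.map_apply,
    AddMonoidAlgebra.single_mul_single]
  exact (map_sum (AddMonoidAlgebra.singleAddHom (γ + δ)) (fun l => u i l * v l j) _).symm

lemma monomialMatrix_smul [AddMonoid Γ] (γ : Γ) (c : k) (u : Matrix ι ι k) :
    monomialMatrix γ (c • u) = c • monomialMatrix γ u := by
  ext1 i j
  simp [monomialMatrix]

lemma monomialMatrix_zero (γ : Γ) : monomialMatrix γ (0 : Matrix ι ι k) = 0 := by
  ext1 i j
  simp [monomialMatrix]

lemma monomialMatrix_eq_zero {γ : Γ} {u : Matrix ι ι k} : monomialMatrix γ u = 0 ↔ u = 0 := by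
  refine ⟨fun h => ?_, fun h => by rw [h, monomialMatrix_zero]⟩
  ext i j
  have := congrFun (congrFun h i) j
  simpa [monomialMatrix] using this

lemma monomialMatrix_one [DecidableEq ι] [AddMonoid Γ] :
    monomialMatrix (0 : Γ) (1 : Matrix ι ι k) = 1 := by
  ext1 i j
  simp only [monomialMatrix, Matrix.map_apply, Matrix.one_apply]
  split_ifs <;> simp [AddMonoidAlgebra.one_def]

end MonomialMatrices

/-- Exponent vectors of Laurent monomials in variables indexed by `ℕ × ℕ`, compared at the
largest position where they differ. -/
abbrev MatExp : Type := Colex ((ℕ ×ₗ ℕ) →₀ ℤ)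

/-- The exponent vector of a variable. -/
noncomputable def varExp (i j : ℕ) : MatExp := toColex (Finsupp.single (toLex (i, j)) 1)

/-- Laurent polynomials in the variables before a given position. -/
def laurentBelow (k : Type*) [Field k] (x : ℕ ×ₗ ℕ) : Subring (AddMonoidAlgebra k MatExp) where
  carrier := {f | ∀ γ, f.coeff γ ≠ 0 → ∀ y, x ≤ y → (ofColex γ) y = 0}
  zero_mem' := fun γ h => by simp at h
  one_mem' := fun γ h y _ => by
    rw [AddMonoidAlgebra.one_def, AddMonoidAlgebra.coeff_single] at h
    have : γ = 0 := by
      by_contra hγ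
      exact h (Finsupp.single_eq_of_ne hγ)
    rw [this]; rfl
  add_mem' := fun {f g} hf hg γ h y hy => by
    by_cases h1 : f.coeff γ = 0
    · refine hg γ (fun h2 => h ?_) y hy
      simp [h1, h2]
    · exact hf γ h1 y hy
  neg_mem' := fun {f} hf γ h y hy => hf γ (fun h1 => h (by
    change (-f).coeff γ = 0
    simp [h1])) y hy
  mul_mem' := fun {f g} hf hg γ h y hy => by
    classical
    have := AddMonoidAlgebra.support_coeff_mul_subset f g (Finsupp.mem_support_iff.mpr h)
    obtain ⟨a, ha, b, hb, rfl⟩ := Finset.mem_add.mp this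
    change (ofColex a) y + (ofColex b) y = 0
    rw [hf a (Finsupp.mem_support_iff.mp ha) y hy, hg b (Finsupp.mem_support_iff.mp hb) y hy,
      add_zero]

lemma hasLead_add_of_mem {k ι : Type*} [Field k] [Fintype ι] [DecidableEq ι] (i j : ℕ)
    (u : Matrix ι ι k) {x : Matrix ι ι (AddMonoidAlgebra k MatExp)}
    (hx : x ∈ (laurentBelow k (toLex (i, j))).matrix) :
    HasLead (monomialMatrix (varExp i j) u + x) (varExp i j) u := by
  have key : ∀ δ, varExp i j ≤ δ → ∀ a b, (x a b).coeff δ = 0 := by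
    intro δ hδ a b
    by_contra h
    have h0 := hx a b δ h
    refine absurd hδ (not_le.mpr ?_)
    rw [Finsupp.Colex.lt_iff]
    refine ⟨toLex (i, j), fun y hy => ?_, ?_⟩
    · rw [h0 y hy.le]
      exact (Finsupp.single_eq_of_ne hy.ne').symm
    · rw [h0 _ le_rfl]
      simp [varExp]
  refine ⟨fun a b => ?_, fun δ hδ a b => ?_⟩
  · simp [monomialMatrix, key _ le_rfl]
  · simp [monomialMatrix, key δ hδ.le, Finsupp.single_eq_of_ne hδ.ne']

lemma monomialMatrix_mem_laurentBelow {k ι : Type*} [Field k] [Fintype ι] [DecidableEq ι]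
    {x y : ℕ ×ₗ ℕ} (hxy : y < x) (c : ℤ) (u : Matrix ι ι k) :
    monomialMatrix (toColex (Finsupp.single y c)) u ∈ (laurentBelow k x).matrix := by
  intro a b γ hγ z hz
  have : γ = toColex (Finsupp.single y c) := by
    by_contra h
    exact hγ (by simp [monomialMatrix, Finsupp.single_eq_of_ne h])
  rw [this]
  exact Finsupp.single_eq_of_ne (hxy.trans_le hz).ne'

section TorusTwist

variable {k ι : Type*} [Field k] [Fintype ι] [DecidableEq ι] {q : k}
  {t p : ℕ → ℕ → Matrix ι ι k}

/-- Adjoining independent central variables to a torus. -/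
lemma TorusData.twist (h : TorusData q t p) :
    TorusData q (fun i j => monomialMatrix (varExp i j) (t i j))
      (fun i j => monomialMatrix (toColex (Finsupp.single (toLex (i, j)) (-1))) (p i j)) where
  row i j l hjl := by
    rw [monomialMatrix_mul, monomialMatrix_mul, h.row i j l hjl, monomialMatrix_smul, add_comm]
  col i s j his := by
    rw [monomialMatrix_mul, monomialMatrix_mul, h.col i s j his, monomialMatrix_smul, add_comm]
  comm i s j l his hjl := by
    rw [monomialMatrix_mul, monomialMatrix_mul, h.comm i s j l his hjl, add_comm]
  inv i j := by
    have h0 : varExp i j + toColex (Finsupp.single (toLex (i, j)) (-1)) = 0 := by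
      rw [varExp, ← toColex_add, ← Finsupp.single_add]
      simp
    rcases h.inv i j with ⟨h1, h2⟩ | ⟨h1, h2⟩
    · left
      rw [monomialMatrix_mul, monomialMatrix_mul, add_comm _ (varExp i j), h0, h1, h2,
        monomialMatrix_one]
      exact ⟨rfl, rfl⟩
    · right
      rw [h1, h2, monomialMatrix_zero, monomialMatrix_zero]
      exact ⟨rfl, rfl⟩
  down i j h0 := by
    rw [h.down i j (monomialMatrix_eq_zero.mp h0), monomialMatrix_zero]

lemma TorusData.hasLead_pathEntry (h : TorusData q t p) (i j : ℕ) :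
    HasLead (pathEntry i (fun i j => monomialMatrix (varExp i j) (t i j))
      (fun i j => monomialMatrix (toColex (Finsupp.single (toLex (i, j)) (-1))) (p i j)) j)
      (varExp i j) (t i j) := by
  have h1 := pathEntry_sub_mem (laurentBelow k (toLex (i, j))).matrix i _ _ h.twist.inv
    h.twist.down j fun i' j' h' => by
      have hlt : toLex (i', j') < toLex (i, j) := by
        rw [Prod.Lex.toLex_lt_toLex]
        exact h'
      exact ⟨monomialMatrix_mem_laurentBelow hlt 1 _, monomialMatrix_mem_laurentBelow hlt (-1) _⟩
  have h2 := hasLead_add_of_mem i j (t i j) h1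
  rwa [add_sub_cancel] at h2

end TorusTwist

/-- The exponent vector of the variable at a hook position. -/
noncomputable def hookExp {n r : ℕ} (a : HookPos n r) : MatExp :=
  varExp (ofLex a.1).1 (ofLex a.1).2

lemma hookExp_sum_apply {n r : ℕ} (l : List (HookPos n r)) (a : HookPos n r) :
    (ofColex ((l.map hookExp).sum)) (toLex (((ofLex a.1).1 : ℕ), ((ofLex a.1).2 : ℕ))) =
      l.count a := by
  induction l with
  | nil => rfl
  | cons b l ih =>
    rw [List.map_cons, List.sum_cons, ofColex_add, Finsupp.add_apply, ih, List.count_cons]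
    have : (ofColex (hookExp b)) (toLex (((ofLex a.1).1 : ℕ), ((ofLex a.1).2 : ℕ))) =
        if b = a then 1 else 0 := by
      rw [hookExp, varExp, ofColex_toColex, Finsupp.single_apply]
      congr 1
      rw [eq_iff_iff, toLex_inj, Prod.mk.injEq, Fin.val_inj, Fin.val_inj, ← Prod.ext_iff,
        ofLex_inj, Subtype.coe_inj]
    rw [this]
    by_cases h : b = a
    · simp [h, add_comm]
    · rw [if_neg h, zero_add, if_neg (fun h' => h (eq_of_beq h')), add_zero]

lemma hookExp_sum_injective {n r : ℕ} :
    Function.Injective fun l : {l : List (HookPos n r) // l.Pairwise (· ≤ ·)} =>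
      (l.1.map hookExp).sum := by
  intro l l' h
  refine Subtype.ext (List.Perm.eq_of_pairwise (fun a b _ _ => le_antisymm) l.2 l'.2 ?_)
  rw [List.perm_iff_count]
  intro a
  have h1 := hookExp_sum_apply l.1 a
  rw [show (l.1.map hookExp).sum = (l'.1.map hookExp).sum from h, hookExp_sum_apply] at h1
  exact_mod_cast h1.symm

/-- A torus with invertible elements at the hook positions gives a faithful representation of the
hook algebra by matrices over a commutative ring. -/
theorem TorusData.exists_faithful {k : Type} [Field k] {q : k} (hq : q ≠ 0) {ι : Type*}
    [Fintype ι] [DecidableEq ι] [Nonempty ι] {t p : ℕ → ℕ → Matrix ι ι k}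
    (h : TorusData q t p) (n r : ℕ) (h0 : ∀ i, n ≤ i → ∀ j, t i j = 0)
    (hu : ∀ a : HookPos n r, IsUnit (t (ofLex a.1).1 (ofLex a.1).2)) :
    ∃ f : QMat k q n n →ₐ[k] Matrix ι ι (AddMonoidAlgebra k MatExp),
      ∀ x ∈ Asub k q n r, f x = 0 → x = 0 := by
  have hM := h.twist.isQMatrix hq n _ _ fun i hi j => by
    rw [h0 i hi j, monomialMatrix_zero]
  refine ⟨hM.hom n n, fun x hx hfx => ?_⟩
  refine injOn_of_linearIndependent_comp (hM.hom n n).toLinearMap _ ?_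
    (Asub_le_span_sorted hq n r hx) hfx
  refine linearIndependent_of_hasLead _ _ hookExp_sum_injective fun l => ?_
  obtain ⟨u, hu1, hu2⟩ := exists_hasLead_wordProd
    (fun a : HookPos n r => hM.hom n n (hookGen k q n r a)) hookExp
    (fun a => ⟨_, hu a, by
      rw [hookGen, hM.hom_Zgen]
      exact h.hasLead_pathEntry _ _⟩) l.1
  refine ⟨u, hu1.ne_zero, ?_⟩
  convert hu2 using 1
  simp only [Function.comp_apply, wordProd, AlgHom.toLinearMap_apply, map_list_prod, List.map_map]
  rfl

lemma Subalgebra.inverse_mem {k T : Type*} [Field k] [Ring T] [Algebra k T] [FiniteDimensional k T]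
    (S : Subalgebra k T) {x y : T} (hx : x ∈ S) (hyx : y * x = 1) : y ∈ S := by
  have hinj : Function.Injective (LinearMap.mulLeft k (⟨x, hx⟩ : S)) := by
    intro a b hab
    have h1 : x * (a : T) = x * b := congrArg Subtype.val hab
    refine Subtype.ext ?_
    calc (a : T) = y * (x * a) := by rw [← mul_assoc, hyx, one_mul]
      _ = b := by rw [h1, ← mul_assoc, hyx, one_mul]
  obtain ⟨z, hz⟩ := LinearMap.injective_iff_surjective.mp hinj 1
  have h1 : x * (z : T) = 1 := congrArg Subtype.val hz
  have : (z : T) = y := by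
    calc (z : T) = y * (x * z) := by rw [← mul_assoc, hyx, one_mul]
      _ = y := by rw [h1, mul_one]
  exact this ▸ z.2

/-- A torus generating a finite dimensional algebra gives a surjective representation of the hook
algebra. -/
theorem TorusData.map_Asub_eq_top {k : Type} [Field k] {q : k} (hq : q ≠ 0) {T : Type*} [Ring T]
    [Algebra k T] [FiniteDimensional k T] {t p : ℕ → ℕ → T}
    (h : TorusData q t p) (n r : ℕ)
    (h0 : ∀ i j, ¬ (i < n ∧ j < n ∧ (i < r ∨ j < r)) → t i j = 0 ∧ p i j = 0)
    (hgen : Algebra.adjoin k (Set.range fun x : ℕ × ℕ => t x.1 x.2) = ⊤) :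
    ∃ f : QMat k q n n →ₐ[k] T, (Asub k q n r).map f = ⊤ := by
  have hM := h.isQMatrix hq n _ _ fun i hi j => (h0 i j (by omega)).1
  refine ⟨hM.hom n n, ?_⟩
  set S := (Asub k q n r).map (hM.hom n n)
  have key : ∀ x : ℕ ×ₗ ℕ, t (ofLex x).1 (ofLex x).2 ∈ S ∧ p (ofLex x).1 (ofLex x).2 ∈ S := by
    intro x
    induction x using WellFoundedLT.induction with
    | ind x ih =>
    obtain ⟨i, j⟩ := x
    change t i j ∈ S ∧ p i j ∈ S
    by_cases hij : i < n ∧ j < n ∧ (i < r ∨ j < r)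
    · have h1 := pathEntry_sub_mem S.toSubring i _ _ h.inv h.down j fun i' j' h' =>
        ih (toLex (i', j')) ((Prod.Lex.toLex_lt_toLex).mpr h')
      have h2 : pathEntry i t p j ∈ S := by
        refine ⟨Zgen k q n n ⟨i, hij.1⟩ ⟨j, hij.2.1⟩,
          Algebra.subset_adjoin ⟨_, _, hij.2.2, rfl⟩, ?_⟩
        exact hM.hom_Zgen n n _ _
      have h3 : t i j ∈ S := by
        have := S.sub_mem h2 h1
        rwa [sub_sub_cancel] at this
      refine ⟨h3, ?_⟩
      rcases h.inv i j with ⟨_, h5⟩ | ⟨_, h5⟩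
      · exact S.inverse_mem h3 h5
      · rw [h5]; exact S.zero_mem
    · rw [(h0 i j hij).1, (h0 i j hij).2]
      exact ⟨S.zero_mem, S.zero_mem⟩
  rw [eq_top_iff, ← hgen, Algebra.adjoin_le_iff]
  rintro _ ⟨x, rfl⟩
  exact (key (toLex x)).1

section PolynomialIdentities

/-- The Capelli polynomial in `N` alternating variables. -/
noncomputable def capelli (N : ℕ) : FreeAlgebra ℤ ℕ :=
  ∑ σ : Equiv.Perm (Fin N), Equiv.Perm.sign σ •
    (List.ofFn fun i : Fin N => FreeAlgebra.ι ℤ (3 * (i : ℕ)) *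
      FreeAlgebra.ι ℤ (3 * (σ i : ℕ) + 1) * FreeAlgebra.ι ℤ (3 * (i : ℕ) + 2)).prod

lemma lift_capelli {A : Type*} [Ring A] (N : ℕ) (f : ℕ → A) :
    FreeAlgebra.lift ℤ f (capelli N) = ∑ σ : Equiv.Perm (Fin N), Equiv.Perm.sign σ •
      (List.ofFn fun i : Fin N => f (3 * (i : ℕ)) * f (3 * (σ i : ℕ) + 1) *
        f (3 * (i : ℕ) + 2)).prod := by
  rw [capelli, map_sum]
  refine Finset.sum_congr rfl fun σ _ => ?_
  rw [Units.smul_def, Units.smul_def, map_zsmul, map_list_prod, List.map_ofFn]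
  congr 3
  funext i
  simp

lemma isPolyIdentity_capelli (R : Type) [CommRing R] (e N : ℕ) (hN : e * e < N) :
    IsPolyIdentity (Matrix (Fin e) (Fin e) R) (capelli N) := by
  intro f
  let M : MultilinearMap R (fun _ : Fin N => Matrix (Fin e) (Fin e) R)
      (Matrix (Fin e) (Fin e) R) :=
    (MultilinearMap.mkPiAlgebraFin R N (Matrix (Fin e) (Fin e) R)).compLinearMap fun i =>
      (LinearMap.mulRight R (f (3 * (i : ℕ) + 2))).comp (LinearMap.mulLeft R (f (3 * (i : ℕ))))
  have h0 : MultilinearMap.alternatization M = 0 := by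
    refine Module.Basis.ext_alternating (Matrix.stdBasis R (Fin e) (Fin e)) fun v hv => ?_
    have := Fintype.card_le_of_injective v hv
    simp only [Fintype.card_fin, Fintype.card_prod] at this
    omega
  have h1 := DFunLike.congr_fun h0 fun i : Fin N => f (3 * (i : ℕ) + 1)
  rw [MultilinearMap.alternatization_apply] at h1
  rw [lift_capelli]
  simpa [M] using h1

lemma not_isPolyIdentity_capelli (R : Type) [CommRing R] [Nontrivial R] (d N : ℕ)
    (hN : N ≤ d * d) (h0 : 0 < N) :
    ¬ IsPolyIdentity (Matrix (Fin d) (Fin d) R) (capelli N) := by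
  have hd : 0 < d := Nat.pos_of_ne_zero fun h => by simp [h] at hN; omega
  obtain ⟨g⟩ : Nonempty (Fin N ↪ Fin d × Fin d) :=
    Function.Embedding.nonempty_of_card_le (by simpa using hN)
  let c : Fin d := ⟨0, hd⟩
  let g' : ℕ → Fin d × Fin d := fun i => if h : i < N then g ⟨i, h⟩ else (c, c)
  have hg' : ∀ i : Fin N, g' i = g i := fun i => by simp [g']
  let f : ℕ → Matrix (Fin d) (Fin d) R := fun x =>
    if x % 3 = 0 then Matrix.single c (g' (x / 3)).1 1
    else if x % 3 = 1 then Matrix.single (g' (x / 3)).1 (g' (x / 3)).2 1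
    else Matrix.single (g' (x / 3)).2 c 1
  have f0 : ∀ i : Fin N, f (3 * (i : ℕ)) = Matrix.single c (g i).1 1 := fun i => by
    simp [f, hg']
  have f1 : ∀ i : Fin N, f (3 * (i : ℕ) + 1) = Matrix.single (g i).1 (g i).2 1 := fun i => by
    have h1 : (3 * (i : ℕ) + 1) % 3 = 1 := by omega
    have h2 : (3 * (i : ℕ) + 1) / 3 = i := by omega
    simp only [f, h1, h2, hg']
    simp
  have f2 : ∀ i : Fin N, f (3 * (i : ℕ) + 2) = Matrix.single (g i).2 c 1 := fun i => by
    have h1 : (3 * (i : ℕ) + 2) % 3 = 2 := by omega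
    have h2 : (3 * (i : ℕ) + 2) / 3 = i := by omega
    simp only [f, h1, h2, hg']
    simp
  intro hf
  have hf := hf f
  revert hf
  rw [lift_capelli, Finset.sum_eq_single 1]
  · have hone : (List.ofFn fun i : Fin N => f (3 * (i : ℕ)) *
        f (3 * ((1 : Equiv.Perm (Fin N)) i : ℕ) + 1) * f (3 * (i : ℕ) + 2)) =
        List.replicate N (Matrix.single c c 1) := by
      rw [← List.ofFn_const]
      congr 1
      funext i
      rw [Equiv.Perm.one_apply, f0, f1, f2]
      simp
    have hid : IsIdempotentElem (Matrix.single c c (1 : R)) := by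
      simp [IsIdempotentElem]
    obtain ⟨N, rfl⟩ : ∃ N', N = N' + 1 := ⟨N - 1, by omega⟩
    rw [hone, List.prod_replicate, hid.pow_succ_eq, Equiv.Perm.sign_one, one_smul]
    intro h
    have := congrFun (congrFun h c) c
    simp at this
  · intro σ _ hσ
    obtain ⟨i, hi⟩ : ∃ i, σ i ≠ i := by
      by_contra! h
      exact hσ (Equiv.ext h)
    rw [List.prod_eq_zero, smul_zero]
    rw [List.mem_ofFn]
    refine ⟨i, ?_⟩
    rw [f0, f1, f2]
    by_cases h1 : (g i).1 = (g (σ i)).1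
    · have h2 : (g (σ i)).2 ≠ (g i).2 := fun h2 => hi (g.injective (Prod.ext h1.symm h2))
      rw [h1, Matrix.single_mul_single_same, Matrix.single_mul_single_of_ne _ _ _ _ h2]
    · rw [Matrix.single_mul_single_of_ne _ _ _ _ h1, zero_mul]
  · simp

lemma map_lift {A B : Type*} [Ring A] [Ring B] (f : A →+* B) (g : ℕ → A)
    (p : FreeAlgebra ℤ ℕ) : f (FreeAlgebra.lift ℤ g p) = FreeAlgebra.lift ℤ (f ∘ g) p := by
  have : f.toIntAlgHom.comp (FreeAlgebra.lift ℤ g) = FreeAlgebra.lift ℤ (f ∘ g) := by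
    ext x
    simp
  exact DFunLike.congr_fun this p

lemma degLE_of_injective {A R : Type} [Ring A] [CommRing R] {d : ℕ}
    (f : A →+* Matrix (Fin d) (Fin d) R) (hf : Function.Injective f) : DegLE A d := by
  intro p hp g
  apply hf
  rw [map_lift, map_zero]
  exact hp R _

lemma le_of_degLE_of_surjective {A R : Type} [Ring A] [CommRing R] [Nontrivial R] {d e : ℕ}
    (h : DegLE A e) (f : A →+* Matrix (Fin d) (Fin d) R) (hf : Function.Surjective f) :
    d ≤ e := by
  by_contra! hlt
  have hN : e * e + 1 ≤ d * d := by nlinarith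
  refine not_isPolyIdentity_capelli R d (e * e + 1) hN (by omega) fun g => ?_
  obtain ⟨g', rfl⟩ : ∃ g', f ∘ g' = g := ⟨fun x => (hf (g x)).choose,
    funext fun x => (hf (g x)).choose_spec⟩
  rw [← map_lift, h _ (fun R _ => isPolyIdentity_capelli R e _ (by omega)) g', map_zero]

end PolynomialIdentities

/-- Burnside's theorem on finite dimensional simple modules. -/
lemma lsmul_surjective_of_isSimpleModule (k : Type*) {A V : Type*} [Field k] [IsAlgClosed k]
    [Ring A] [Algebra k A] [AddCommGroup V] [Module k V] [Module A V] [IsScalarTower k A V]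
    [IsSimpleModule A V] [FiniteDimensional k V] :
    Function.Surjective (Algebra.lsmul k k V : A →ₐ[k] Module.End k V) := by
  classical
  intro f
  let f' : Module.End (Module.End A V) V :=
    { toFun := f
      map_add' := f.map_add
      map_smul' := fun g v => by
        obtain ⟨c, rfl⟩ := (IsSimpleModule.algebraMap_end_bijective_of_isAlgClosed (A := A) k).2 g
        simp }
  let b := Module.finBasis k V
  obtain ⟨a, ha⟩ := jacobson_density f' (Finset.univ.image b)
  refine ⟨a, b.ext fun i => ?_⟩
  exact (ha (b i) (Finset.mem_image_of_mem _ (Finset.mem_univ i))).symm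

/-- Matrix form of Burnside's theorem. -/
lemma exists_surjective_matrix_of_isSimpleModule (k : Type*) (A V : Type*) [Field k]
    [IsAlgClosed k] [Ring A] [Algebra k A] [AddCommGroup V] [Module k V] [Module A V]
    [IsScalarTower k A V] [IsSimpleModule A V] [FiniteDimensional k V] :
    ∃ f : A →ₐ[k] Matrix (Fin (Module.finrank k V)) (Fin (Module.finrank k V)) k,
      Function.Surjective f :=
  ⟨(LinearMap.toMatrixAlgEquiv (Module.finBasis k V)).toAlgHom.comp (Algebra.lsmul k k V),
    (LinearMap.toMatrixAlgEquiv (Module.finBasis k V)).surjective.comp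
      (lsmul_surjective_of_isSimpleModule k)⟩

/-- A projective representation of a finite abelian group with cocycle `χ ∘ B`. -/
structure IsWeylRep {G k E : Type*} [AddCommGroup G] [Field k] [Ring E] [Algebra k E] {m : ℕ}
    (χ : AddChar (ZMod m) k) (B : G →+ G →+ ZMod m) (ρ : G → E) : Prop where
  zero : ρ 0 = 1
  mul : ∀ u v, ρ u * ρ v = χ (B v u) • ρ (u + v)

/-- The radical of the alternating form attached to `B`. -/
def weylRadical {G : Type*} [AddCommGroup G] {m : ℕ} (B : G →+ G →+ ZMod m) : AddSubgroup G :=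
  (B - B.flip).ker

namespace IsWeylRep

variable {G k E : Type*} [AddCommGroup G] [Field k] [Ring E] [Algebra k E] {m : ℕ}
  {χ : AddChar (ZMod m) k} {B : G →+ G →+ ZMod m} {ρ : G → E}

lemma mem_weylRadical {u : G} : u ∈ weylRadical B ↔ ∀ v, B u v = B v u := by
  simp [weylRadical, AddMonoidHom.mem_ker, DFunLike.ext_iff, sub_eq_zero]

lemma comm (h : IsWeylRep χ B ρ) (u v : G) :
    ρ u * ρ v = χ (B v u - B u v) • (ρ v * ρ u) := by
  rw [h.mul u v, h.mul v u, smul_smul, ← AddChar.map_add_eq_mul, sub_add_cancel, add_comm]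

lemma isUnit (h : IsWeylRep χ B ρ) (u : G) : IsUnit (ρ u) := by
  have key : ∀ c : ZMod m, χ c * χ (-c) = 1 := fun c => by
    rw [← AddChar.map_add_eq_mul, add_neg_cancel, AddChar.map_zero_eq_one]
  have key' : ∀ c : ZMod m, χ (-c) * χ c = 1 := fun c => by rw [mul_comm, key]
  refine ⟨⟨ρ u, χ (B u u) • ρ (-u), ?_, ?_⟩, rfl⟩
  · rw [mul_smul_comm, h.mul, smul_smul, add_neg_cancel, h.zero, map_neg, AddMonoidHom.neg_apply,
      key, one_smul]
  · rw [smul_mul_assoc, h.mul, smul_smul, neg_add_cancel, h.zero, map_neg, key, one_smul]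

end IsWeylRep

/-- The dimension of an irreducible projective representation of a finite abelian group. -/
theorem IsWeylRep.card_eq {G k : Type*} [AddCommGroup G] [Finite G] [Field k] [CharZero k] {m d : ℕ}
    {χ : AddChar (ZMod m) k} (hχ : ∀ a, χ a = 1 → a = 0) {B : G →+ G →+ ZMod m}
    {ρ : G → Matrix (Fin d) (Fin d) k} (hd : 0 < d)
    (h : IsWeylRep χ B ρ) (hspan : Submodule.span k (Set.range ρ) = ⊤) :
    Nat.card G = d * d * Nat.card (weylRadical B) := by
  have hχ0 : ∀ a, χ a ≠ 0 := fun a h0 => by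
    have := AddChar.map_add_eq_mul χ a (-a)
    rw [add_neg_cancel, AddChar.map_zero_eq_one, h0, zero_mul] at this
    exact one_ne_zero this
  have hscalar : ∀ u ∈ weylRadical B, ∃ c : k, ρ u = algebraMap k _ c := by
    intro u hu
    rw [mem_weylRadical] at hu
    have hmem : ρ u ∈ Subalgebra.center k (Matrix (Fin d) (Fin d) k) := by
      rw [Subalgebra.mem_center_iff]
      intro x
      have hx : x ∈ Submodule.span k (Set.range ρ) := hspan ▸ Submodule.mem_top
      induction hx using Submodule.span_induction with
      | mem x hx =>
        obtain ⟨v, rfl⟩ := hx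
        rw [h.comm v u, hu v, sub_self, AddChar.map_zero_eq_one, one_smul]
      | zero => rw [zero_mul, mul_zero]
      | add x y _ _ hx hy => rw [add_mul, mul_add, hx, hy]
      | smul c x _ hx => rw [smul_mul_assoc, mul_smul_comm, hx]
    rw [Algebra.IsCentral.center_eq_bot] at hmem
    obtain ⟨c, hc⟩ := Algebra.mem_bot.mp hmem
    exact ⟨c, hc.symm⟩
  have htrace : ∀ u ∉ weylRadical B, (ρ u).trace = 0 := by
    intro u hu
    rw [mem_weylRadical] at hu
    push Not at hu
    obtain ⟨v, hv⟩ := hu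
    obtain ⟨g, hg⟩ := h.isUnit v
    have h1 := h.comm u v
    have h2 : ((g⁻¹ : (Matrix (Fin d) (Fin d) k)ˣ) : Matrix (Fin d) (Fin d) k) * (ρ u * ρ v) =
        χ (B v u - B u v) • ρ u := by
      rw [h1, ← hg, mul_smul_comm, ← mul_assoc, Units.inv_mul, one_mul]
    have h3 : (ρ u).trace = χ (B v u - B u v) * (ρ u).trace := by
      rw [← smul_eq_mul, ← Matrix.trace_smul, ← h2, Matrix.trace_mul_comm, ← hg, mul_assoc,
        Units.mul_inv, mul_one]
    have h4 : χ (B v u - B u v) ≠ 1 := fun h5 => hv (sub_eq_zero.mp (hχ _ h5)).symm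
    have h5 : (χ (B v u - B u v) - 1) * (ρ u).trace = 0 := by rw [sub_mul, one_mul, ← h3, sub_self]
    exact (mul_eq_zero.mp h5).resolve_left (sub_ne_zero.mpr h4)
  let Q := G ⧸ weylRadical B
  have : Fintype Q := Fintype.ofFinite Q
  have hli : LinearIndependent k fun x : Q => ρ x.out := by
    rw [Fintype.linearIndependent_iff]
    intro c hc x
    have h1 : (∑ y : Q, c y • (ρ y.out * ρ (-x.out))).trace = 0 := by
      simp only [← smul_mul_assoc]
      rw [← Finset.sum_mul, hc, zero_mul, Matrix.trace_zero]
    rw [Matrix.trace_sum, Finset.sum_eq_single x] at h1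
    · rw [h.mul, add_neg_cancel, h.zero, Matrix.trace_smul, Matrix.trace_smul, Matrix.trace_one,
        smul_eq_mul, smul_eq_mul, Fintype.card_fin, mul_eq_zero, mul_eq_zero] at h1
      rcases h1 with h1 | h1 | h1
      · exact h1
      · exact absurd h1 (hχ0 _)
      · exact absurd (Nat.cast_eq_zero.mp h1) hd.ne'
    · intro y _ hy
      rw [h.mul, Matrix.trace_smul, Matrix.trace_smul, htrace, smul_zero, smul_zero]
      intro h2
      refine hy ?_
      rw [← y.out_eq', ← x.out_eq']
      refine (QuotientAddGroup.eq.mpr ?_).symm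
      rwa [add_comm]
    · simp
  have hsp : ⊤ ≤ Submodule.span k (Set.range fun x : Q => ρ x.out) := by
    rw [← hspan, Submodule.span_le]
    rintro _ ⟨u, rfl⟩
    let x : Q := QuotientAddGroup.mk u
    have hx : -x.out + u ∈ weylRadical B :=
      QuotientAddGroup.eq.mp (x.out_eq')
    obtain ⟨c, hc⟩ := hscalar _ hx
    have h1 := h.mul x.out (-x.out + u)
    rw [add_neg_cancel_left, hc, ← Algebra.commutes, ← Algebra.smul_def] at h1
    have h2 : ρ u = (χ (B (-x.out + u) x.out))⁻¹ • (c • ρ x.out) := by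
      rw [h1, smul_smul, inv_mul_cancel₀ (hχ0 _), one_smul]
    rw [h2]
    exact Submodule.smul_mem _ _ (Submodule.smul_mem _ _ (Submodule.subset_span ⟨x, rfl⟩))
  have h1 := Module.finrank_eq_card_basis (Module.Basis.mk hli hsp)
  rw [Module.finrank_matrix, Fintype.card_fin, Module.finrank_self, mul_one] at h1
  rw [AddSubgroup.card_eq_card_quotient_mul_card_addSubgroup (weylRadical B), h1,
    Nat.card_eq_fintype_card]

/-- An algebra with a nonzero finite dimensional module has a full matrix algebra as a quotient. -/
lemma exists_surjective_matrix (k A P : Type*) [Field k] [IsAlgClosed k] [Ring A] [Algebra k A]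
    [AddCommGroup P] [Module k P] [Module A P] [IsScalarTower k A P] [FiniteDimensional k P]
    [Nontrivial P] :
    ∃ d : ℕ, 0 < d ∧ ∃ f : A →ₐ[k] Matrix (Fin d) (Fin d) k, Function.Surjective f := by
  have : IsArtinian A P := isArtinian_of_tower k inferInstance
  obtain ⟨V, hV, -⟩ := (IsAtomic.eq_bot_or_exists_atom_le (⊤ : Submodule A P)).resolve_left
    top_ne_bot
  have : IsSimpleModule A V := isSimpleModule_iff_isAtom.mpr hV
  have : FiniteDimensional k V :=
    FiniteDimensional.of_injective (V.subtype.restrictScalars k) V.subtype_injective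
  have : Nontrivial V := IsSimpleModule.nontrivial A V
  exact ⟨_, Module.finrank_pos, exists_surjective_matrix_of_isSimpleModule k A V⟩

/-- Existence of irreducible projective representations with a prescribed cocycle. -/
theorem exists_isWeylRep {G k : Type*} [AddCommGroup G] [Finite G] [Field k] [IsAlgClosed k]
    {m : ℕ} (χ : AddChar (ZMod m) k) (B : G →+ G →+ ZMod m) :
    ∃ (d : ℕ) (ρ : G → Matrix (Fin d) (Fin d) k), 0 < d ∧ IsWeylRep χ B ρ ∧
      Submodule.span k (Set.range ρ) = ⊤ := by
  let W : G → Module.End k (G → k) := fun u =>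
    { toFun := fun φ x => χ (B u x) * φ (x + u)
      map_add' := fun φ ψ => by funext x; simp [mul_add]
      map_smul' := fun c φ => by funext x; simp [mul_left_comm] }
  have hW : ∀ u φ x, W u φ x = χ (B u x) * φ (x + u) := fun _ _ _ => rfl
  have hrep : IsWeylRep χ B W := by
    constructor
    · ext1 φ
      funext x
      rw [hW, map_zero, AddMonoidHom.zero_apply, AddChar.map_zero_eq_one, one_mul, add_zero]
      rfl
    · intro u v
      ext1 φ
      funext x
      rw [Module.End.mul_apply, hW, hW, LinearMap.smul_apply, Pi.smul_apply, hW,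
        map_add (B v), map_add B,
        AddMonoidHom.add_apply, AddChar.map_add_eq_mul, AddChar.map_add_eq_mul, smul_eq_mul,
        add_assoc]
      ring
  obtain ⟨S, hmem⟩ : ∃ S : Subalgebra k (Module.End k (G → k)),
      ∀ x, x ∈ S ↔ x ∈ Submodule.span k (Set.range W) :=
    ⟨(Submodule.span k (Set.range W)).toSubalgebra
      (hrep.zero ▸ Submodule.subset_span ⟨0, rfl⟩) (by
        intro x y hx hy
        induction hx using Submodule.span_induction with
        | mem x hx =>
          obtain ⟨u, rfl⟩ := hx
          induction hy using Submodule.span_induction with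
          | mem y hy =>
            obtain ⟨v, rfl⟩ := hy
            rw [hrep.mul]
            exact Submodule.smul_mem _ _ (Submodule.subset_span ⟨_, rfl⟩)
          | zero => rw [mul_zero]; exact Submodule.zero_mem _
          | add a b _ _ ha hb => rw [mul_add]; exact Submodule.add_mem _ ha hb
          | smul c a _ ha => rw [mul_smul_comm]; exact Submodule.smul_mem _ _ ha
        | zero => rw [zero_mul]; exact Submodule.zero_mem _
        | add a b _ _ ha hb => rw [add_mul]; exact Submodule.add_mem _ ha hb
        | smul c a _ ha => rw [smul_mul_assoc]; exact Submodule.smul_mem _ _ ha), fun _ => Iff.rfl⟩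
  have : Fintype G := Fintype.ofFinite G
  obtain ⟨d, hd, f, hf⟩ := exists_surjective_matrix k S (G → k)
  have hS : ∀ u, W u ∈ S := fun u => (hmem _).mpr (Submodule.subset_span ⟨u, rfl⟩)
  refine ⟨d, fun u => f ⟨W u, hS u⟩, hd, ⟨?_, ?_⟩, ?_⟩
  · rw [← map_one f]
    exact congrArg f (Subtype.ext hrep.zero)
  · intro u v
    rw [← map_mul, ← map_smul]
    exact congrArg f (Subtype.ext (hrep.mul u v))
  · rw [eq_top_iff]
    rintro y -
    obtain ⟨⟨a, ha'⟩, rfl⟩ := hf y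
    have ha := (hmem a).mp ha'
    induction ha using Submodule.span_induction with
    | mem a ha =>
      obtain ⟨u, rfl⟩ := ha
      exact Submodule.subset_span ⟨u, rfl⟩
    | zero =>
      exact (congrArg (· ∈ _) (map_zero f)).mpr (Submodule.zero_mem _)
    | add a b h1 h2 ha hb =>
      exact (congrArg (· ∈ _) (map_add f ⟨a, (hmem a).mpr h1⟩ ⟨b, (hmem b).mpr h2⟩)).mpr
        (Submodule.add_mem _ (ha _) (hb _))
    | smul c a h1 ha =>
      exact (congrArg (· ∈ _) (map_smul f c ⟨a, (hmem a).mpr h1⟩)).mpr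
        (Submodule.smul_mem _ c (ha _))

section FormOfMatrix

variable {L R : Type*} [Fintype L] [CommRing R]

/-- The bilinear form `(u, v) ↦ ∑ b x y * v x * u y`. -/
def formOfMatrix (b : L → L → R) : (L → R) →+ (L → R) →+ R :=
  AddMonoidHom.mk' (fun u => AddMonoidHom.mk' (fun v => ∑ x, ∑ y, b x y * v x * u y)
    fun v w => by simp only [Pi.add_apply, mul_add, add_mul, Finset.sum_add_distrib])
    fun u w => by
      ext1 v
      simp only [AddMonoidHom.mk'_apply, AddMonoidHom.add_apply, Pi.add_apply, mul_add,
        Finset.sum_add_distrib]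

lemma formOfMatrix_apply (b : L → L → R) (u v : L → R) :
    formOfMatrix b u v = ∑ x, ∑ y, b x y * v x * u y := rfl

variable [DecidableEq L]

lemma formOfMatrix_single (b : L → L → R) (x y : L) :
    formOfMatrix b (Pi.single y 1) (Pi.single x 1) = b x y := by
  rw [formOfMatrix_apply, Finset.sum_eq_single x, Finset.sum_eq_single y]
  · simp
  · intro z _ hz; simp [hz]
  · simp
  · intro z _ hz; simp [hz]
  · simp

lemma mem_weylRadical_formOfMatrix {m : ℕ} {b : L → L → ZMod m} {u : L → ZMod m} :
    u ∈ weylRadical (formOfMatrix b) ↔ ∀ x, ∑ y, (b x y - b y x) * u y = 0 := by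
  rw [IsWeylRep.mem_weylRadical]
  have key : ∀ v, formOfMatrix b u v - formOfMatrix b v u =
      ∑ x, v x * ∑ y, (b x y - b y x) * u y := by
    intro v
    rw [formOfMatrix_apply, formOfMatrix_apply, Finset.sum_comm (f := fun x y => b x y * u x * v y),
      ← Finset.sum_sub_distrib]
    refine Finset.sum_congr rfl fun x _ => ?_
    rw [Finset.mul_sum, ← Finset.sum_sub_distrib]
    exact Finset.sum_congr rfl fun y _ => by ring
  constructor
  · intro h x
    have := key (Pi.single x 1)
    rw [h, sub_self, Finset.sum_eq_single x (fun y _ hy => by simp [hy]) (by simp)] at this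
    simpa using this.symm
  · intro h v
    rw [← sub_eq_zero, key]
    exact Finset.sum_eq_zero fun x _ => by rw [h, mul_zero]

lemma IsWeylRep.adjoin_single_eq_top {k E : Type*} [Field k] [Ring E] [Algebra k E] {m : ℕ}
    [NeZero m] {χ : AddChar (ZMod m) k} {B : (L → ZMod m) →+ (L → ZMod m) →+ ZMod m}
    {ρ : (L → ZMod m) → E} (h : IsWeylRep χ B ρ)
    (hspan : Submodule.span k (Set.range ρ) = ⊤) :
    Algebra.adjoin k (Set.range fun x => ρ (Pi.single x 1)) = ⊤ := by
  set S := Algebra.adjoin k (Set.range fun x => ρ (Pi.single x 1))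
  let M : AddSubmonoid (L → ZMod m) :=
    { carrier := {u | ρ u ∈ S}
      zero_mem' := by
        change ρ 0 ∈ S
        rw [h.zero]
        exact S.one_mem
      add_mem' := fun {u v} hu hv => by
        have h1 := AddChar.map_add_eq_mul χ (-B v u) (B v u)
        rw [neg_add_cancel, AddChar.map_zero_eq_one] at h1
        have h2 : ρ (u + v) = χ (-B v u) • (ρ u * ρ v) := by
          rw [h.mul, smul_smul, ← h1, one_smul]
        change ρ (u + v) ∈ S
        rw [h2]
        exact S.smul_mem (S.mul_mem hu hv) _ }
  have hM : ∀ u, u ∈ M := by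
    intro u
    rw [← Finset.univ_sum_single u]
    refine M.sum_mem fun x _ => ?_
    have h1 : Pi.single x (u x) = (u x).val • (Pi.single x 1 : L → ZMod m) := by
      rw [← Pi.single_smul, nsmul_one, ZMod.natCast_zmod_val]
    rw [h1]
    exact M.nsmul_mem (Algebra.subset_adjoin ⟨x, rfl⟩) _
  rw [← Algebra.toSubmodule_eq_top, eq_top_iff, ← hspan, Submodule.span_le]
  rintro _ ⟨u, rfl⟩
  exact hM u

end FormOfMatrix

/-- The positions `(i, j)` in an `n × n` matrix with `i < r` or `j < r`. -/
def hook (n r : ℕ) : Finset (ℕ × ℕ) :=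
  (Finset.range n ×ˢ Finset.range n).filter fun x => x.1 < r ∨ x.2 < r

lemma mem_hook {n r : ℕ} {x : ℕ × ℕ} :
    x ∈ hook n r ↔ x.1 < n ∧ x.2 < n ∧ (x.1 < r ∨ x.2 < r) := by
  simp [hook, and_assoc]

/-- The exponents of `q` in the commutation relations of the hook torus, before
antisymmetrization. -/
def hookForm {R : Type*} [CommRing R] (x y : ℕ × ℕ) : R :=
  (if x.1 = y.1 ∧ x.2 < y.2 then 1 else 0) + if x.2 = y.2 ∧ x.1 < y.1 then 1 else 0

/-- A projective representation of `(ZMod m) ^ hook` gives a torus. -/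
theorem IsWeylRep.exists_torusData {k E : Type*} [Field k] [Ring E] [Algebra k E] {m : ℕ}
    {q : k} {χ : AddChar (ZMod m) k} (hχ : χ 1 = q) (n r : ℕ)
    {ρ : (hook n r → ZMod m) → E}
    (h : IsWeylRep χ (formOfMatrix fun x y => hookForm x.1 y.1) ρ) :
    ∃ t p : ℕ → ℕ → E, TorusData q t p ∧
      (∀ x : hook n r, t x.1.1 x.1.2 = ρ (Pi.single x 1)) ∧
      ∀ i j, (i, j) ∉ hook n r → t i j = 0 ∧ p i j = 0 := by
  choose g hg using h.isUnit
  let t : ℕ → ℕ → E := fun i j =>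
    if hij : (i, j) ∈ hook n r then ρ (Pi.single ⟨(i, j), hij⟩ 1) else 0
  let p : ℕ → ℕ → E := fun i j =>
    if hij : (i, j) ∈ hook n r then ↑(g (Pi.single ⟨(i, j), hij⟩ 1))⁻¹ else 0
  have ht : ∀ i j (hij : (i, j) ∈ hook n r), t i j = ρ (Pi.single ⟨(i, j), hij⟩ 1) :=
    fun i j hij => dif_pos hij
  have ht0 : ∀ i j, (i, j) ∉ hook n r → t i j = 0 := fun i j hij => dif_neg hij
  have hcomm : ∀ i j s l (c : k), (χ (hookForm (i, j) (s, l) - hookForm (s, l) (i, j)) = c) →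
      t i j * t s l = c • (t s l * t i j) := by
    intro i j s l c hc
    by_cases h1 : (i, j) ∈ hook n r
    · by_cases h2 : (s, l) ∈ hook n r
      · rw [ht _ _ h1, ht _ _ h2, h.comm, formOfMatrix_single, formOfMatrix_single, hc]
      · simp [ht0 _ _ h2]
    · simp [ht0 _ _ h1]
  refine ⟨t, p, ⟨?_, ?_, ?_, ?_, ?_⟩, fun x => ht _ _ x.2,
    fun i j hij => ⟨ht0 i j hij, dif_neg hij⟩⟩
  · intro i j l hjl
    refine hcomm _ _ _ _ _ ?_
    simp [hookForm, hjl, hjl.ne, hjl.ne', hjl.not_gt, hχ]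
  · intro i s j his
    refine hcomm _ _ _ _ _ ?_
    simp [hookForm, his, his.ne, his.ne', his.not_gt, hχ]
  · intro i s j l his hjl
    rw [hcomm i j s l 1, one_smul]
    simp [hookForm, his, hjl, his.symm, hjl.symm, AddChar.map_zero_eq_one]
  · intro i j
    by_cases hij : (i, j) ∈ hook n r
    · left
      rw [ht _ _ hij, ← hg, show p i j = _ from dif_pos hij]
      exact ⟨Units.mul_inv _, Units.inv_mul _⟩
    · exact Or.inr ⟨ht0 i j hij, dif_neg hij⟩
  · intro i j hij
    by_cases hE : Nontrivial E
    · refine ht0 _ _ fun hmem => ?_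
      have hmem' : (i, j) ∈ hook n r := by
        rw [mem_hook] at hmem ⊢
        simp only at hmem ⊢
        omega
      rw [ht _ _ hmem'] at hij
      exact (h.isUnit _).ne_zero hij
    · rw [not_nontrivial_iff_subsingleton] at hE
      exact Subsingleton.elim _ _

section HookKernel

variable {R : Type*} [CommRing R]

/-- `∑ sign (l - j) * f l` over `l < n`. -/
def signSum (n : ℕ) (f : ℕ → R) (j : ℕ) : R :=
  ∑ l ∈ Finset.range n, ((if j < l then 1 else 0) - if l < j then 1 else 0) * f l

lemma signSum_sub_succ {n : ℕ} (f : ℕ → R) {j : ℕ} (hj : j + 1 < n) :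
    signSum n f j - signSum n f (j + 1) = f j + f (j + 1) := by
  rw [signSum, signSum, ← Finset.sum_sub_distrib,
    ← Finset.sum_subset (s₁ := {j, j + 1}) (by intro x; simp; omega), Finset.sum_pair (by omega)]
  · simp
  · intro l _ hl
    simp only [Finset.mem_insert, Finset.mem_singleton, not_or] at hl
    rcases lt_or_gt_of_ne hl.1 with h | h
    · simp [h, h.not_gt, show l < j + 1 by omega, show ¬ j + 1 < l by omega]
    · simp [h, h.not_gt, show ¬ l < j + 1 by omega, show j + 1 < l by omega]

lemma signSum_zero (n : ℕ) (f : ℕ → R) :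
    signSum (n + 1) f 0 = ∑ l ∈ Finset.range n, f (l + 1) := by
  rw [signSum, Finset.sum_range_succ']
  simp

/-- The pairing of the array `V` with the position `(i, j)` under the alternating form of the
hook torus. -/
def hookPairing (n : ℕ) (V : ℕ → ℕ → R) (i j : ℕ) : R :=
  signSum n (V i) j + signSum n (fun s => V s j) i

lemma hookPairing_swap (n : ℕ) (V : ℕ → ℕ → R) (i j : ℕ) :
    hookPairing n (fun a b => V b a) i j = hookPairing n V j i :=
  add_comm _ _

lemma hookPairing_second_difference {n : ℕ} (V : ℕ → ℕ → R) {i j : ℕ} (hi : i + 1 < n)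
    (hj : j + 1 < n) :
    hookPairing n V i j - hookPairing n V i (j + 1) -
      (hookPairing n V (i + 1) j - hookPairing n V (i + 1) (j + 1)) =
      2 * (V i j - V (i + 1) (j + 1)) := by
  simp only [hookPairing]
  linear_combination signSum_sub_succ (V i) hj - signSum_sub_succ (V (i + 1)) hj +
    signSum_sub_succ (fun s => V s j) hi - signSum_sub_succ (fun s => V s (j + 1)) hi

lemma hookPairing_zero_zero (n : ℕ) (V : ℕ → ℕ → R) :
    hookPairing (n + 1) V 0 0 = ∑ l ∈ Finset.range n, (V 0 (l + 1) + V (l + 1) 0) := by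
  rw [hookPairing, signSum_zero, signSum_zero, Finset.sum_add_distrib]

lemma hookPairing_sub_succ {n : ℕ} (V : ℕ → ℕ → R) {j : ℕ} (hj : j < n) :
    hookPairing (n + 1) V 0 j - hookPairing (n + 1) V 0 (j + 1) =
      V 0 (j + 1) + V n j + ∑ s ∈ Finset.range n, (V s j - V (s + 1) (j + 1)) := by
  have h1 := signSum_sub_succ (n := n + 1) (V 0) (j := j) (by omega)
  have h2 := Finset.sum_range_succ' (fun s => V s j) n
  rw [Finset.sum_range_succ] at h2
  rw [hookPairing, hookPairing, signSum_zero, signSum_zero, Finset.sum_sub_distrib]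
  linear_combination h1 - h2

/-- An array supported on the hook and constant along its diagonals. -/
structure IsHookToeplitz (n r : ℕ) (V : ℕ → ℕ → R) : Prop where
  supp : ∀ i j, (i, j) ∉ hook n r → V i j = 0
  diag : ∀ i j, (i + 1, j + 1) ∈ hook n r → V (i + 1) (j + 1) = V i j

namespace IsHookToeplitz

variable {n r : ℕ} {V : ℕ → ℕ → R}

lemma swap (h : IsHookToeplitz n r V) : IsHookToeplitz n r fun i j => V j i where
  supp i j hij := h.supp j i fun h' => hij (by rw [mem_hook] at h' ⊢; simp only at h' ⊢; omega)
  diag i j hij := h.diag j i (by rw [mem_hook] at hij ⊢; simp only at hij ⊢; omega)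

lemma add_add (h : IsHookToeplitz n r V) (a i j : ℕ) (hij : (i + a, j + a) ∈ hook n r) :
    V (i + a) (j + a) = V i j := by
  induction a with
  | zero => rfl
  | succ a ih =>
    rw [← add_assoc, ← add_assoc, h.diag (i + a) (j + a) hij, ih]
    rw [mem_hook] at hij ⊢
    simp only at hij ⊢
    omega

lemma hookPairing_sub_of_lt (h : IsHookToeplitz (n + 1) r V) {j : ℕ} (hj : j < n)
    (hjr : j + 1 < r) :
    hookPairing (n + 1) V 0 j - hookPairing (n + 1) V 0 (j + 1) =
      V 0 (j + 1) + V (n - j) 0 := by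
  rw [hookPairing_sub_succ V hj, Finset.sum_eq_zero, add_zero]
  · have := h.add_add j (n - j) 0 (by rw [mem_hook]; simp only; omega)
    rw [Nat.sub_add_cancel hj.le, zero_add] at this
    rw [this]
  · intro s hs
    rw [Finset.mem_range] at hs
    rw [h.diag, sub_self]
    rw [mem_hook]; simp only; omega

lemma hookPairing_sub_of_ge (h : IsHookToeplitz (n + 1) r V) {j : ℕ} (hr : 0 < r)
    (hj : j + r < n) :
    hookPairing (n + 1) V 0 (j + r) - hookPairing (n + 1) V 0 (j + r + 1) =
      V 0 (j + r + 1) + V 0 (j + 1) := by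
  rw [hookPairing_sub_succ V hj, Finset.sum_eq_single (r - 1)]
  · have h1 := h.add_add (r - 1) 0 (j + 1) (by rw [mem_hook]; simp only; omega)
    rw [zero_add, show j + 1 + (r - 1) = j + r by omega] at h1
    rw [h1, h.supp n (j + r), h.supp (r - 1 + 1) (j + r + 1)]
    · ring
    · rw [mem_hook]; simp only; omega
    · rw [mem_hook]; simp only; omega
  · intro s hs hsr
    rw [Finset.mem_range] at hs
    rcases lt_or_ge (s + 1) r with h1 | h1
    · rw [h.diag, sub_self]
      rw [mem_hook]; simp only; omega
    · rw [h.supp s, h.supp (s + 1), sub_self]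
      · rw [mem_hook]; simp only; omega
      · rw [mem_hook]; simp only; omega
  · intro h1
    rw [Finset.mem_range] at h1
    omega

lemma hookPairing_sub_of_eq (h : IsHookToeplitz (n + 1) (r + 1) V) (hr : r < n) :
    hookPairing (n + 1) V 0 r - hookPairing (n + 1) V 0 (r + 1) =
      V 0 (r + 1) + ∑ e ∈ Finset.range (n - r + 1), V e 0 := by
  rw [hookPairing_sub_succ V hr, add_assoc]
  congr 1
  have h1 : ∀ e ∈ Finset.range (n - r + 1), V e 0 = V (r + e) r := by
    intro e he
    rw [Finset.mem_range] at he
    have := h.add_add r e 0 (by rw [mem_hook]; simp only; omega)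
    rw [zero_add, add_comm e] at this
    exact this.symm
  rw [Finset.sum_congr rfl h1, Finset.sum_range_succ, add_comm (V n r), Nat.add_sub_cancel' hr.le]
  congr 1
  obtain ⟨c, rfl⟩ := Nat.exists_eq_add_of_le hr.le
  rw [Finset.sum_range_add, Finset.sum_eq_zero, zero_add, Nat.add_sub_cancel_left]
  · refine Finset.sum_congr rfl fun s _ => ?_
    rw [h.supp (r + s + 1) (r + 1), sub_zero]
    rw [mem_hook]; simp only; omega
  · intro s hs
    rw [Finset.mem_range] at hs
    rw [h.diag, sub_self]
    rw [mem_hook]; simp only; omega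

end IsHookToeplitz

end HookKernel

section HookKernel

variable {R : Type*} [CommRing R]

lemma isHookToeplitz_of_hookPairing_eq_zero (h2 : IsUnit (2 : R)) {n r : ℕ} {V : ℕ → ℕ → R}
    (hs : ∀ i j, (i, j) ∉ hook n r → V i j = 0)
    (h : ∀ i j, (i, j) ∈ hook n r → hookPairing n V i j = 0) : IsHookToeplitz n r V where
  supp := hs
  diag i j hij := by
    have hij' := hij
    rw [mem_hook] at hij'
    simp only at hij'
    have h1 := hookPairing_second_difference V hij'.1 hij'.2.1
    rw [h _ _ hij, h i j, h i (j + 1), h (i + 1) j] at h1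
    · simp only [sub_self] at h1
      exact (sub_eq_zero.mp (h2.mul_right_eq_zero.mp h1.symm)).symm
    all_goals rw [mem_hook]; simp only; omega

namespace IsHookToeplitz

variable {n r : ℕ} {V : ℕ → ℕ → R}

lemma row_add_col_eq_zero (hV : IsHookToeplitz n r V)
    (h : ∀ j, (0, j) ∈ hook n r → hookPairing n V 0 j = 0) {j : ℕ} (hj : 0 < j) (hjn : j < n)
    (hjr : j < r) : V 0 j + V (n - j) 0 = 0 := by
  obtain ⟨j, rfl⟩ := Nat.exists_eq_succ_of_ne_zero hj.ne'
  obtain ⟨n, rfl⟩ := Nat.exists_eq_succ_of_ne_zero (show n ≠ 0 by omega)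
  have h1 := hV.hookPairing_sub_of_lt (j := j) (by omega) hjr
  rw [h, h, sub_self] at h1
  · rw [show n.succ - j.succ = n - j by omega, Nat.succ_eq_add_one, ← h1]
  all_goals rw [mem_hook]; simp only; omega

lemma row_add_row_eq_zero (hV : IsHookToeplitz n r V)
    (h : ∀ j, (0, j) ∈ hook n r → hookPairing n V 0 j = 0) {j : ℕ} (hj : 0 < j) (hr : 0 < r)
    (hjn : j + r < n) : V 0 (j + r) + V 0 j = 0 := by
  obtain ⟨j, rfl⟩ := Nat.exists_eq_succ_of_ne_zero hj.ne'
  obtain ⟨n, rfl⟩ := Nat.exists_eq_succ_of_ne_zero (show n ≠ 0 by omega)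
  have h1 := hV.hookPairing_sub_of_ge (j := j) hr (by omega)
  rw [h, h, sub_self] at h1
  · rw [Nat.succ_eq_add_one, h1, add_right_comm]
  all_goals rw [mem_hook]; simp only; omega

lemma row_add_sum_col_eq_zero (hV : IsHookToeplitz n r V)
    (h : ∀ j, (0, j) ∈ hook n r → hookPairing n V 0 j = 0) (hr : 0 < r)
    (hrn : r < n) : V 0 r + ∑ e ∈ Finset.range (n - r + 1), V e 0 = 0 := by
  obtain ⟨r, rfl⟩ := Nat.exists_eq_succ_of_ne_zero hr.ne'
  obtain ⟨n, rfl⟩ := Nat.exists_eq_succ_of_ne_zero (show n ≠ 0 by omega)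
  have h1 := hV.hookPairing_sub_of_eq (by omega)
  rw [h, h, sub_self] at h1
  · rw [show n.succ - r.succ = n - r by omega, Nat.succ_eq_add_one, ← h1]
  all_goals rw [mem_hook]; simp only; omega

lemma eq_zero_of_hookPairing_eq_zero (hV : IsHookToeplitz n r V) (hr : 0 < r) (hrn : r ≤ n)
    (h : ∀ i j, (i, j) ∈ hook n r → hookPairing n V i j = 0)
    (h0 : ∀ j, 0 < j → j ≤ r → V 0 j = 0) (h00 : r = n → V 0 0 = 0) (i j : ℕ) : V i j = 0 := by
  have hrow : ∀ j, (0, j) ∈ hook n r → hookPairing n V 0 j = 0 := fun j hj => h _ _ hj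
  have hcol : ∀ j, (0, j) ∈ hook n r → hookPairing n (fun i j => V j i) 0 j = 0 := by
    intro j hj
    rw [hookPairing_swap]
    refine h _ _ ?_
    rw [mem_hook] at hj ⊢
    simp only at hj ⊢
    omega
  have hy : ∀ j, 0 < j → V 0 j = 0 := by
    intro j
    induction j using Nat.strong_induction_on with
    | _ j ih =>
    intro hj
    by_cases hjr : j ≤ r
    · exact h0 j hj hjr
    · by_cases hjn : j < n
      · have h1 := hV.row_add_row_eq_zero hrow (j := j - r) (by omega) hr (by omega)
        rwa [ih (j - r) (by omega) (by omega), Nat.sub_add_cancel (by omega), add_zero] at h1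
      · refine hV.supp _ _ ?_
        rw [mem_hook]; simp only; omega
  have hzr : ∀ j, 0 < j → j < r → V j 0 = 0 := by
    intro j hj hjr
    have h1 := hV.swap.row_add_col_eq_zero hcol hj (by omega) hjr
    rwa [hy (n - j) (by omega), add_zero] at h1
  have hzn : ∀ j, n - r < j → V j 0 = 0 := by
    intro j hj
    by_cases hjn : j < n
    · have h1 := hV.row_add_col_eq_zero hrow (j := n - j) (by omega) (by omega) (by omega)
      rwa [hy (n - j) (by omega), zero_add, Nat.sub_sub_self hjn.le] at h1
    · refine hV.supp _ _ ?_
      rw [mem_hook]; simp only; omega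
  have hx0 : V 0 0 = 0 := by
    rcases hrn.eq_or_lt with h1 | h1
    · exact h00 h1
    · have h2 := hV.row_add_sum_col_eq_zero hrow hr h1
      rw [hy r hr, zero_add, Finset.sum_range_succ'] at h2
      obtain ⟨n, rfl⟩ := Nat.exists_eq_succ_of_ne_zero (show n ≠ 0 by omega)
      have h3 := hookPairing_zero_zero n V
      rw [hrow 0 (by rw [mem_hook]; simp only; omega), Finset.sum_add_distrib,
        Finset.sum_eq_zero (fun l _ => hy (l + 1) (by omega)), zero_add,
        ← Finset.sum_subset (s₁ := Finset.range (n.succ - r))] at h3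
      · rwa [← h3, zero_add] at h2
      · intro l
        simp only [Finset.mem_range]
        omega
      · intro l _ hl
        rw [Finset.mem_range] at hl
        exact hzn _ (by omega)
  have hz : ∀ j, V j 0 = 0 := by
    intro j
    induction j using Nat.strong_induction_on with
    | _ j ih =>
    rcases Nat.eq_zero_or_pos j with rfl | hj
    · exact hx0
    by_cases hjn : j < n
    · rcases lt_trichotomy j r with hjr | rfl | hjr
      · exact hzr j hj hjr
      · have h1 := hV.swap.row_add_sum_col_eq_zero hcol hr hjn
        rwa [Finset.sum_eq_zero, add_zero] at h1
        intro e _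
        rcases Nat.eq_zero_or_pos e with rfl | he
        · exact hx0
        · exact hy e he
      · have h1 := hV.swap.row_add_row_eq_zero hcol (j := j - r) (by omega) hr (by omega)
        rwa [ih (j - r) (by omega), Nat.sub_add_cancel (by omega), add_zero] at h1
    · refine hV.supp _ _ ?_
      rw [mem_hook]; simp only; omega
  by_cases hij : (i, j) ∈ hook n r
  · rcases le_total i j with h1 | h1
    · obtain ⟨c, rfl⟩ := Nat.exists_eq_add_of_le h1
      have h2 := hV.add_add i 0 c (by rwa [zero_add, add_comm c])
      rw [zero_add, add_comm c] at h2
      rw [h2]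
      rcases Nat.eq_zero_or_pos c with rfl | hc
      · exact hx0
      · exact hy c hc
    · obtain ⟨c, rfl⟩ := Nat.exists_eq_add_of_le h1
      have h2 := hV.add_add j c 0 (by rwa [zero_add, add_comm c])
      rw [zero_add, add_comm c] at h2
      rw [h2, hz]
  · exact hV.supp _ _ hij

/-- Sufficient conditions for a row of pairings to vanish. -/
lemma hookPairing_row_eq_zero (hV : IsHookToeplitz n r V) (hr : 0 < r)
    (h00 : hookPairing n V 0 0 = 0)
    (h1 : ∀ j, 0 < j → j < n → V 0 j + V (n - j) 0 = 0)
    (h2 : ∀ j, 0 < j → j + r < n → V 0 (j + r) + V 0 j = 0)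
    (h3 : r < n → V 0 r + ∑ e ∈ Finset.range (n - r + 1), V e 0 = 0) (j : ℕ) (hj : j < n) :
    hookPairing n V 0 j = 0 := by
  induction j with
  | zero => exact h00
  | succ j ih =>
    obtain ⟨n, rfl⟩ := Nat.exists_eq_succ_of_ne_zero (show n ≠ 0 by omega)
    have key : hookPairing (n + 1) V 0 j - hookPairing (n + 1) V 0 (j + 1) = 0 := by
      rcases lt_trichotomy (j + 1) r with hjr | rfl | hjr
      · rw [hV.hookPairing_sub_of_lt (by omega) hjr, ← h1 (j + 1) (by omega) hj,
          show n.succ - (j + 1) = n - j by omega]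
      · rw [hV.hookPairing_sub_of_eq (by omega), ← h3 hj,
          show n.succ - (j + 1) = n - j by omega]
      · obtain ⟨j, rfl⟩ := Nat.exists_eq_add_of_le' (show r ≤ j by omega)
        rw [hV.hookPairing_sub_of_ge hr (by omega), ← h2 (j + 1) (by omega) (by omega),
          add_right_comm]
    rw [ih (by omega), zero_sub, neg_eq_zero] at key
    exact key

lemma hookPairing_eq_zero (hV : IsHookToeplitz n r V)
    (hrow : ∀ j, j < n → hookPairing n V 0 j = 0) (hcol : ∀ i, i < n → hookPairing n V i 0 = 0)
    (i : ℕ) : ∀ j, (i, j) ∈ hook n r → hookPairing n V i j = 0 := by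
  induction i with
  | zero => exact fun j hj => hrow j (by rw [mem_hook] at hj; exact hj.2.1)
  | succ i ih =>
    intro j
    induction j with
    | zero => exact fun hi => hcol _ (by rw [mem_hook] at hi; exact hi.1)
    | succ j ihj =>
      intro hij
      have hij' := hij
      rw [mem_hook] at hij'
      simp only at hij'
      have h1 := hookPairing_second_difference V hij'.1 hij'.2.1
      rw [hV.diag _ _ hij, ih j, ih (j + 1), ihj] at h1
      · linear_combination h1
      all_goals rw [mem_hook]; simp only; omega

end IsHookToeplitz

end HookKernel

section HookKernel

variable {R : Type*} [CommRing R]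

lemma exists_isHookToeplitz {n r : ℕ} (hr : 0 < r) (hrn : r ≤ n) (Y : ℕ → R)
    (hY : ∀ j, 0 < j → Y (j + r) = -Y j) :
    ∃ V, IsHookToeplitz n r V ∧ (∀ i j, (i, j) ∈ hook n r → hookPairing n V i j = 0) ∧
      (∀ j, 0 < j → j < n → V 0 j = Y j) ∧ (r = n → V 0 0 = -Y n) := by
  let x : R := if r = n then -Y n else -∑ j ∈ Finset.range (n - r - 1), Y (j + 1)
  let V : ℕ → ℕ → R := fun i j =>
    if (i, j) ∈ hook n r then if i < j then Y (j - i) else if j < i then -Y (n - (i - j)) else x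
    else 0
  have hmem0 : ∀ {j}, j < n → (0, j) ∈ hook n r := fun h => by rw [mem_hook]; simp only; omega
  have hmem1 : ∀ {j}, j < n → (j, 0) ∈ hook n r := fun h => by rw [mem_hook]; simp only; omega
  have hVy : ∀ j, 0 < j → j < n → V 0 j = Y j := fun j hj hjn => by
    simp only [V, if_pos (hmem0 hjn), if_pos hj, Nat.sub_zero]
  have hVz : ∀ j, 0 < j → j < n → V j 0 = -Y (n - j) := fun j hj hjn => by
    simp only [V, if_pos (hmem1 hjn), if_pos hj, hj.not_gt, if_false, Nat.sub_zero]
  have hVx : V 0 0 = x := by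
    simp only [V, if_pos (hmem0 (show 0 < n by omega)), lt_irrefl, if_false]
  have hV : IsHookToeplitz n r V := by
    refine ⟨fun i j hij => if_neg hij, fun i j hij => ?_⟩
    have hij' : (i, j) ∈ hook n r := by rw [mem_hook] at hij ⊢; simp only at hij ⊢; omega
    simp only [V, if_pos hij, if_pos hij', Nat.add_lt_add_iff_right, Nat.add_sub_add_right]
  have h1 : ∀ j, 0 < j → j < n → V 0 j + V (n - j) 0 = 0 := fun j hj hjn => by
    rw [hVy j hj hjn, hVz (n - j) (by omega) (by omega), Nat.sub_sub_self hjn.le, add_neg_cancel]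
  have h1' : ∀ j, 0 < j → j < n → V j 0 + V 0 (n - j) = 0 := fun j hj hjn => by
    rw [hVy (n - j) (by omega) (by omega), hVz j hj hjn, neg_add_cancel]
  have h2 : ∀ j, 0 < j → j + r < n → V 0 (j + r) + V 0 j = 0 := fun j hj hjn => by
    rw [hVy j hj (by omega), hVy _ (by omega) hjn, hY j hj, neg_add_cancel]
  have h2' : ∀ j, 0 < j → j + r < n → V (j + r) 0 + V j 0 = 0 := fun j hj hjn => by
    have h3 := hY (n - (j + r)) (by omega)
    rw [hVz j hj (by omega), hVz _ (by omega) hjn, ← h3,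
      show n - (j + r) + r = n - j by omega, add_neg_cancel]
  have hx : r < n → x = -∑ j ∈ Finset.range (n - r - 1), Y (j + 1) := fun h => if_neg h.ne
  have hsum : ∀ j ∈ Finset.range (n - r - 1), Y (j + 1) = -Y (j + 1 + r) := fun j _ => by
    rw [hY _ (by omega), neg_neg]
  have h3 : r < n → V 0 r + ∑ e ∈ Finset.range (n - r + 1), V e 0 = 0 := fun h => by
    rw [show n - r + 1 = n - r - 1 + 1 + 1 by omega, Finset.sum_range_succ', hVx, hx h,
      hVy r hr h, Finset.sum_range_succ, hVz _ (by omega) (by omega),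
      show n - (n - r - 1 + 1) = r by omega, Finset.sum_congr rfl hsum, Finset.sum_neg_distrib,
      ← Finset.sum_range_reflect]
    have h4 : ∀ e ∈ Finset.range (n - r - 1), V (n - r - 1 - 1 - e + 1) 0 = -Y (e + 1 + r) := by
      intro e he
      rw [Finset.mem_range] at he
      rw [hVz _ (by omega) (by omega)]
      congr 2
      omega
    rw [Finset.sum_congr rfl h4, Finset.sum_neg_distrib]
    ring
  have h3' : r < n → V r 0 + ∑ e ∈ Finset.range (n - r + 1), V 0 e = 0 := fun h => by
    rw [show n - r + 1 = n - r - 1 + 1 + 1 by omega, Finset.sum_range_succ', hVx, hx h,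
      hVz r hr h, Finset.sum_range_succ, hVy _ (by omega) (by omega),
      show n - r - 1 + 1 = n - r by omega]
    have h4 : ∀ e ∈ Finset.range (n - r - 1), V 0 (e + 1) = Y (e + 1) := by
      intro e he
      rw [Finset.mem_range] at he
      exact hVy _ (by omega) (by omega)
    rw [Finset.sum_congr rfl h4]
    ring
  have h00 : hookPairing n V 0 0 = 0 := by
    obtain ⟨n, rfl⟩ := Nat.exists_eq_succ_of_ne_zero (show n ≠ 0 by omega)
    rw [hookPairing_zero_zero, Finset.sum_add_distrib, ← Finset.sum_range_reflect,
      ← Finset.sum_add_distrib]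
    refine Finset.sum_eq_zero fun l hl => ?_
    rw [Finset.mem_range] at hl
    rw [show n - 1 - l + 1 = n.succ - (l + 1) by omega, add_comm]
    exact h1' (l + 1) (by omega) (by omega)
  refine ⟨V, hV, hV.hookPairing_eq_zero (hV.hookPairing_row_eq_zero hr h00 h1 h2 h3) ?_, hVy,
    fun h => by rw [hVx]; exact if_pos h⟩
  intro i hi
  rw [← hookPairing_swap]
  exact hV.swap.hookPairing_row_eq_zero hr (by rw [hookPairing_swap, h00]) h1' h2' h3' i hi

lemma sum_hookForm {n r : ℕ} {V : ℕ → ℕ → R} (hs : ∀ i j, (i, j) ∉ hook n r → V i j = 0)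
    {i j : ℕ} (hi : i < n) (hj : j < n) :
    ∑ y : hook n r, (hookForm (i, j) y.1 - hookForm y.1 (i, j)) * V y.1.1 y.1.2 =
      hookPairing n V i j := by
  have hsub : hook n r ⊆ Finset.range n ×ˢ Finset.range n := Finset.filter_subset _ _
  rw [Finset.sum_coe_sort (hook n r) fun y => (hookForm (i, j) y - hookForm y (i, j)) * V y.1 y.2,
    Finset.sum_subset hsub
      (fun y _ hy => by rw [hs y.1 y.2 hy, mul_zero]), Finset.sum_product]
  have key : ∀ s l, ((hookForm (i, j) (s, l) : R) - hookForm (s, l) (i, j)) * V s l =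
      (if i = s then ((if j < l then 1 else 0) - if l < j then 1 else 0) * V s l else 0) +
      if j = l then ((if i < s then 1 else 0) - if s < i then 1 else 0) * V s l else 0 := by
    intro s l
    by_cases h1 : i = s <;> by_cases h2 : j = l <;> simp [hookForm, h1, h2, eq_comm]
  simp only [key, Finset.sum_add_distrib]
  rw [hookPairing, signSum, signSum]
  congr 1
  · rw [Finset.sum_comm]
    simp [hi]
  · simp [hj]

/-- The radical of the form of the hook torus has `m ^ r` elements. -/
theorem card_weylRadical_hookForm {m : ℕ} (hm : Odd m) {n r : ℕ} (hr : 0 < r) (hrn : r ≤ n) :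
    Nat.card (weylRadical (formOfMatrix fun x y : hook n r =>
      (hookForm x.1 y.1 : ZMod m))) = m ^ r := by
  have : NeZero m := ⟨hm.pos.ne'⟩
  have h2 : IsUnit (2 : ZMod m) := by
    have := (ZMod.unitOfCoprime 2 (Nat.coprime_two_left.mpr hm)).isUnit
    rwa [ZMod.coe_unitOfCoprime] at this
  set K := weylRadical (formOfMatrix fun x y : hook n r => (hookForm x.1 y.1 : ZMod m))
  let X : (hook n r → ZMod m) → ℕ → ℕ → ZMod m := fun u i j =>
    if h : (i, j) ∈ hook n r then u ⟨(i, j), h⟩ else 0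
  have hX : ∀ (u : hook n r → ZMod m) (y : hook n r), X u y.1.1 y.1.2 = u y :=
    fun u y => dif_pos y.2
  have hX0 : ∀ u i j, (i, j) ∉ hook n r → X u i j = 0 := fun u i j h => dif_neg h
  have hK : ∀ u, u ∈ K ↔ ∀ i j, (i, j) ∈ hook n r → hookPairing n (X u) i j = 0 := by
    intro u
    rw [mem_weylRadical_formOfMatrix]
    refine ⟨fun h i j hij => ?_, fun h x => ?_⟩
    · have h1 := h ⟨(i, j), hij⟩
      rw [mem_hook] at hij
      rw [← sum_hookForm (hX0 u) hij.1 hij.2.1, ← h1]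
      exact Finset.sum_congr rfl fun y _ => by rw [hX]
    · obtain ⟨⟨i, j⟩, hij⟩ := x
      rw [← h i j hij]
      rw [mem_hook] at hij
      rw [← sum_hookForm (hX0 u) hij.1 hij.2.1]
      exact Finset.sum_congr rfl fun y _ => by rw [hX]
  let Ψ : K →+ (Fin r → ZMod m) := AddMonoidHom.mk'
    (fun u a => if (a : ℕ) + 1 = n then -X u.1 0 0 else X u.1 0 (a + 1)) (by
      have hadd : ∀ u v i j, X (u + v) i j = X u i j + X v i j := by
        intro u v i j
        by_cases h : (i, j) ∈ hook n r
        · simp only [X, dif_pos h, Pi.add_apply]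
        · rw [hX0 _ _ _ h, hX0 _ _ _ h, hX0 _ _ _ h, add_zero]
      intro u v
      funext a
      simp only [AddSubgroup.coe_add, hadd, Pi.add_apply]
      split_ifs
      · ring
      · rfl)
  have hΨ : ∀ (u : K) (a : Fin r),
      Ψ u a = if (a : ℕ) + 1 = n then -X u.1 0 0 else X u.1 0 (a + 1) :=
    fun _ _ => rfl
  have hbij : Function.Bijective Ψ := by
    constructor
    · rw [injective_iff_map_eq_zero]
      intro u hu
      have hu' := (hK u.1).mp u.2
      have hV := isHookToeplitz_of_hookPairing_eq_zero h2 (hX0 u.1) hu'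
      have h0 := hV.eq_zero_of_hookPairing_eq_zero hr hrn hu' (fun j hj hjr => ?_) fun h => ?_
      · ext y
        rw [← hX u.1 y, h0]
        rfl
      · by_cases hjn : j < n
        · have h1 := congrFun hu ⟨j - 1, by omega⟩
          rw [hΨ] at h1
          simp only [Nat.sub_add_cancel hj, hjn.ne, if_false] at h1
          exact h1
        · refine hX0 _ _ _ ?_
          rw [mem_hook]; simp only; omega
      · have h1 := congrFun hu ⟨r - 1, by omega⟩
        rw [hΨ] at h1
        rw [if_pos (by simp only; omega)] at h1
        exact neg_eq_zero.mp h1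
    · intro c
      let Y : ℕ → ZMod m := fun j => (-1) ^ ((j - 1) / r) * c ⟨(j - 1) % r, Nat.mod_lt _ hr⟩
      have hY : ∀ j, 0 < j → Y (j + r) = -Y j := by
        intro j hj
        simp only [Y, show j + r - 1 = j - 1 + r by omega, Nat.add_div_right _ hr,
          Nat.add_mod_right, pow_succ]
        ring
      have hYc : ∀ a : Fin r, Y (a + 1) = c a := by
        intro a
        simp only [Y, Nat.add_sub_cancel, Nat.div_eq_of_lt a.2, Nat.mod_eq_of_lt a.2, pow_zero,
          one_mul]
      obtain ⟨V, hV, hV0, hVY, hVn⟩ := exists_isHookToeplitz hr hrn Y hY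
      have hXV : X (fun y => V y.1.1 y.1.2) = V := by
        funext i j
        by_cases h : (i, j) ∈ hook n r
        · exact dif_pos h
        · exact (hX0 (fun y => V y.1.1 y.1.2) i j h).trans (hV.supp _ _ h).symm
      refine ⟨⟨fun y => V y.1.1 y.1.2, (hK _).mpr (by rwa [hXV])⟩, ?_⟩
      funext a
      rw [hΨ]
      simp only [hXV]
      rw [← hYc]
      split_ifs with h
      · rw [hVn (by omega), neg_neg, h]
      · exact hVY _ (by omega) (by omega)
  rw [Nat.card_congr (Equiv.ofBijective Ψ hbij), Nat.card_fun, Nat.card_zmod, Nat.card_fin]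

lemma card_hook {n r : ℕ} (hrn : r ≤ n) : (hook n r).card + r * r = 2 * (n * r) := by
  obtain ⟨c, rfl⟩ := Nat.exists_eq_add_of_le hrn
  have h1 : (Finset.range (r + c) ×ˢ Finset.range (r + c)).filter (fun x => ¬ (x.1 < r ∨ x.2 < r)) =
      Finset.Ico r (r + c) ×ˢ Finset.Ico r (r + c) := by
    ext x
    simp only [Finset.mem_filter, Finset.mem_product, Finset.mem_range, Finset.mem_Ico]
    omega
  have h2 := Finset.card_filter_add_card_filter_not
    (s := Finset.range (r + c) ×ˢ Finset.range (r + c))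
    (fun x => x.1 < r ∨ x.2 < r)
  rw [h1] at h2
  simp only [Finset.card_product, Nat.card_Ico, Finset.card_range, Nat.add_sub_cancel_left] at h2
  change (hook (r + c) r).card + _ = _ at h2
  nlinarith

end HookKernel

/-- At a primitive `m`-th root of unity the hook torus has an irreducible representation of
dimension `m ^ (n * r - r * (r + 1) / 2)`. -/
theorem exists_irreducible_torusData {k : Type*} [Field k] [IsAlgClosed k] [CharZero k] {q : k}
    {m : ℕ} (hodd : Odd m) (hq : IsPrimitiveRoot q m) {n r : ℕ} (hr : 0 < r) (hrn : r ≤ n) :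
    ∃ t p : ℕ → ℕ → Matrix (Fin (m ^ (n * r - r * (r + 1) / 2)))
        (Fin (m ^ (n * r - r * (r + 1) / 2))) k,
      TorusData q t p ∧ (∀ i j, (i, j) ∈ hook n r → IsUnit (t i j)) ∧
      (∀ i j, (i, j) ∉ hook n r → t i j = 0 ∧ p i j = 0) ∧
      Algebra.adjoin k (Set.range fun x : ℕ × ℕ => t x.1 x.2) = ⊤ := by
  have : NeZero m := ⟨hodd.pos.ne'⟩
  let χ := AddChar.zmodChar m hq.pow_eq_one
  have hχ : ∀ a, χ a = 1 → a = 0 := by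
    intro a ha
    rw [AddChar.zmodChar_apply, hq.pow_eq_one_iff_dvd] at ha
    rw [← ZMod.val_eq_zero]
    exact Nat.eq_zero_of_dvd_of_lt ha a.val_lt
  have hχ1 : χ 1 = q := by
    have := AddChar.zmodChar_apply' hq.pow_eq_one 1
    rwa [Nat.cast_one, pow_one] at this
  obtain ⟨d, ρ, hd, hρ, hspan⟩ := exists_isWeylRep χ
    (formOfMatrix fun x y : hook n r => (hookForm x.1 y.1 : ZMod m))
  have hcard := hρ.card_eq hχ hd hspan
  rw [card_weylRadical_hookForm hodd hr hrn, Nat.card_fun, Nat.card_zmod,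
    Nat.card_eq_fintype_card, Fintype.card_coe] at hcard
  have hd' : d = m ^ (n * r - r * (r + 1) / 2) := by
    have h1 := card_hook hrn
    have h2 : r * (r + 1) / 2 * 2 = r * (r + 1) :=
      Nat.div_mul_cancel (even_iff_two_dvd.mp (Nat.even_mul_succ_self r))
    have h3 : r * r ≤ n * r := Nat.mul_le_mul_right r hrn
    have h4 : r ≤ r * r := Nat.le_mul_self r
    have h5 : (hook n r).card = 2 * (n * r - r * (r + 1) / 2) + r := by
      rw [mul_add, mul_one] at h2
      rw [mul_add, mul_one]
      omega
    rw [h5, pow_add] at hcard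
    have h6 := Nat.eq_of_mul_eq_mul_right (pow_pos hodd.pos r) hcard
    rw [two_mul, pow_add] at h6
    exact (Nat.mul_self_inj.mp h6).symm
  subst hd'
  obtain ⟨t, p, htp, ht, h0⟩ := hρ.exists_torusData hχ1 n r
  refine ⟨t, p, htp, fun i j hij => ?_, h0, ?_⟩
  · rw [ht ⟨(i, j), hij⟩]
    exact hρ.isUnit _
  · rw [eq_top_iff, ← hρ.adjoin_single_eq_top hspan]
    refine Algebra.adjoin_mono ?_
    rintro _ ⟨x, rfl⟩
    exact ⟨x.1, ht x⟩

/-- A surjection onto a full matrix algebra gives a simple module. -/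
lemma exists_isSimpleModule_of_surjective {k A : Type} [Field k] [Ring A] [Algebra k A] {d : ℕ}
    (hd : 0 < d) (f : A →ₐ[k] Matrix (Fin d) (Fin d) k) (hf : Function.Surjective f) :
    ∃ (V : Type) (_ : AddCommGroup V) (_ : Module k V) (_ : Module A V) (_ : IsScalarTower k A V),
      IsSimpleModule A V ∧ Module.Finite k V ∧ d = Module.finrank k V := by
  let g : A →ₐ[k] Module.End k (Fin d → k) := Matrix.toLinAlgEquiv'.toAlgHom.comp f
  have hg : Function.Surjective g := Matrix.toLinAlgEquiv'.surjective.comp hf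
  let : Module A (Fin d → k) := Module.compHom _ g.toRingHom
  have hsmul : ∀ (a : A) (v : Fin d → k), a • v = g a v := fun _ _ => rfl
  have : NeZero d := ⟨hd.ne'⟩
  refine ⟨Fin d → k, inferInstance, inferInstance, inferInstance, ⟨fun c a v => ?_⟩, ?_,
    inferInstance, by simp⟩
  · rw [hsmul, hsmul, map_smul]
    rfl
  · refine isSimpleModule_iff_toSpanSingleton_surjective.mpr ⟨inferInstance, fun v hv w => ?_⟩
    obtain ⟨φ, hφ⟩ := (isSimpleModule_iff_toSpanSingleton_surjective
      (R := Module.End k (Fin d → k)).mp inferInstance).2 v hv w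
    obtain ⟨a, rfl⟩ := hg φ
    exact ⟨a, hφ⟩

/-- A surjection onto `d × d` matrices realizes the upper bound `d` on the degree. -/
lemma hasDeg_and_sSup_finrank_eq {k A : Type} [Field k] [IsAlgClosed k] [Ring A] [Algebra k A]
    {d : ℕ} (hd : 0 < d) (hle : DegLE A d) (f : A →ₐ[k] Matrix (Fin d) (Fin d) k)
    (hf : Function.Surjective f) :
    HasDeg A d ∧
      sSup {c : ℕ | ∃ (V : Type) (_ : AddCommGroup V) (_ : Module k V) (_ : Module A V)
          (_ : IsScalarTower k A V),
          IsSimpleModule A V ∧ Module.Finite k V ∧ c = Module.finrank k V} = d := by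
  refine ⟨⟨hle, fun e he => le_of_degLE_of_surjective he f.toRingHom hf⟩,
    IsGreatest.csSup_eq ⟨exists_isSimpleModule_of_surjective hd f hf, ?_⟩⟩
  rintro _ ⟨V, _, _, _, _, _, _, rfl⟩
  obtain ⟨φ, hφ⟩ := exists_surjective_matrix_of_isSimpleModule k A V
  exact le_of_degLE_of_surjective hle φ.toRingHom hφ

/-- For `k` algebraically closed of characteristic zero, `m` odd,
`q` a primitive `m`-th root of unity and `1 ≤ r ≤ n`,
`deg A_{n,r} = m^(nr - r(r+1)/2)`; equivalently the supremum of the dimensions of the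
finite-dimensional irreducible `A_{n,r}`-modules is `m^(nr - r(r+1)/2)`. -/
theorem deg_Asub
    (k : Type) [Field k] [IsAlgClosed k] [CharZero k] (q : k) (m : ℕ)
    (hm : 0 < m) (hodd : Odd m) (hq : IsPrimitiveRoot q m)
    (n r : ℕ) (hr : 1 ≤ r) (hrn : r ≤ n) :
    HasDeg (Asub k q n r) (m ^ (n * r - r * (r + 1) / 2)) ∧
      sSup {c : ℕ | ∃ (V : Type) (_ : AddCommGroup V) (_ : Module k V)
          (_ : Module (Asub k q n r) V) (_ : IsScalarTower k (Asub k q n r) V),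
          IsSimpleModule (Asub k q n r) V ∧ Module.Finite k V ∧
            c = Module.finrank k V} =
        m ^ (n * r - r * (r + 1) / 2) := by
  have hq0 : q ≠ 0 := hq.ne_zero hm.ne'
  have hpos : 0 < m ^ (n * r - r * (r + 1) / 2) := pow_pos hm _
  obtain ⟨t, p, htp, hu, h0, hgen⟩ := exists_irreducible_torusData hodd hq hr hrn
  have : Nonempty (Fin (m ^ (n * r - r * (r + 1) / 2))) := ⟨⟨0, hpos⟩⟩
  obtain ⟨f, hf⟩ := htp.exists_faithful hq0 n r
    (fun i hi j => (h0 i j (by rw [mem_hook]; simp only; omega)).1)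
    (fun a => hu _ _ (mem_hook.mpr ⟨Fin.is_lt _, Fin.is_lt _, a.2⟩))
  have hle : DegLE (Asub k q n r) (m ^ (n * r - r * (r + 1) / 2)) := by
    refine degLE_of_injective (f.comp (Asub k q n r).val).toRingHom ?_
    rw [injective_iff_map_eq_zero]
    exact fun x hx => Subtype.ext (hf x x.2 hx)
  obtain ⟨g, hg⟩ := htp.map_Asub_eq_top hq0 n r
    (fun i j hij => h0 i j (by rwa [mem_hook])) hgen
  have hsurj : Function.Surjective (g.comp (Asub k q n r).val) := by
    intro y
    have hy : y ∈ (Asub k q n r).map g := hg ▸ Algebra.mem_top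
    obtain ⟨x, hx, rfl⟩ := hy
    exact ⟨⟨x, hx⟩, rfl⟩
  exact hasDeg_and_sSup_finrank_eq hpos hle _ hsurj
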